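/- arXiv:2309.12947 — 2 statements merged into one kernel-verified Lean document; each statement's English description precedes it below -/
import Mathlib

section
/- Fix n ≥ 2, K ≥ 1, α ≥ 1, κ > 0, and p > (n−1)/K^{1/(n−1)}. Let μ be a positive Borel measure on B and suppose there is a constant C > 0 such that ∫_B |f(x)|^{αp} dμ(x) ≤ C (∫_{S^{n−1}} |f̃(ω)|^p dσ(ω))^α holds for every K-quasiregular mapping f : B → ℝⁿ \ {0} in the Miniowitz class (Min) satisfying the multiplicity condition (M) with some exponent 0 ≤ a < n−1 (f̃ denoting the non-tangential limit function of f). Then μ is an α-Carleson measure on B. In particular, if p > n−1 this conclusion holds for every K ≥ 1. -/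
open MeasureTheory Metric Set Filter
open scoped ENNReal NNReal Topology Classical

noncomputable section

abbrev Vec (n : ℕ) := EuclideanSpace ℝ (Fin n)

/-- The open unit ball in `ℝⁿ`. -/
def unitBall (n : ℕ) : Set (Vec n) := Metric.ball 0 1

/-- The unit sphere `S^{n-1}` in `ℝⁿ`. -/
def unitSphere (n : ℕ) : Set (Vec n) := Metric.sphere 0 1

/-- Surface measure on the unit sphere, modelled by `(n-1)`-dimensional
Hausdorff measure restricted to the sphere. -/
def sphMeasure (n : ℕ) : Measure (Vec n) := (μH[(n : ℝ) - 1]).restrict (unitSphere n)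

/-- `f` is `K`-quasiregular on the unit ball. -/
def IsQR (n : ℕ) (K : ℝ) (f : Vec n → Vec n) : Prop :=
  ContinuousOn f (unitBall n) ∧
  (∀ x ∈ unitBall n, DifferentiableAt ℝ f x) ∧
  (∀ᵐ x ∂(volume.restrict (unitBall n)),
    ‖fderiv ℝ f x‖ ^ n ≤ K * (fderiv ℝ f x).det)

/-- The conformal automorphism `T_x` of the unit ball (with `T_0 = id`). -/
def mobiusT (n : ℕ) (x : Vec n) (y : Vec n) : Vec n :=
  if x = 0 then y
  else (‖x‖ ^ 2 * ‖y - (‖x‖ ^ 2)⁻¹ • x‖ ^ 2)⁻¹ •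
    ((1 - ‖x‖ ^ 2) • (y - x) - ‖y - x‖ ^ 2 • x)

/-- The Miniowitz class (Min) with constants `C₀, α`. -/
def InMiniowitz (n : ℕ) (C₀ α : ℝ) (f : Vec n → Vec n) : Prop :=
  ∀ x ∈ unitBall n, ∀ y ∈ unitBall n,
    C₀⁻¹ * ((1 - ‖y‖) / (1 + ‖y‖)) ^ α ≤ ‖f (mobiusT n (-x) y)‖ / ‖f (mobiusT n (-x) 0)‖ ∧
    ‖f (mobiusT n (-x) y)‖ / ‖f (mobiusT n (-x) 0)‖ ≤ C₀ * ((1 + ‖y‖) / (1 - ‖y‖)) ^ α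

/-- The multiplicity condition (M) with exponent `a` and constant `C₁`. -/
def MultCond (n : ℕ) (a C₁ : ℝ) (f : Vec n → Vec n) : Prop :=
  ∀ x ∈ unitBall n, ∀ r : ℝ, 0 < r → r < 1 → ∀ y : Vec n,
    (({z ∈ Metric.ball (0 : Vec n) r | f (mobiusT n (-x) z) = y}).encard : ℝ≥0∞) ≤
      ENNReal.ofReal (C₁ / (1 - r) ^ a)

/-- The non-tangential region `Γ(ω)` with aperture parameter `κ`. -/
def ntRegion (n : ℕ) (κ : ℝ) (ω : Vec n) : Set (Vec n) :=
  {x ∈ unitBall n | ‖x - ω‖ < (1 + κ) * (1 - ‖x‖)}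

/-- The non-tangential maximal function `f*`. -/
def ntMax (n : ℕ) (κ : ℝ) (f : Vec n → Vec n) (ω : Vec n) : ℝ≥0∞ :=
  ⨆ x ∈ ntRegion n κ ω, ENNReal.ofReal ‖f x‖

/-- `f` has the non-tangential limit `L` at `ω`. -/
def HasNTLimit (n : ℕ) (κ : ℝ) (f : Vec n → Vec n) (ω L : Vec n) : Prop :=
  Filter.Tendsto f (𝓝[ntRegion n κ ω] ω) (𝓝 L)

/-- The `p`-th mean of `f` on the sphere of radius `r`. -/
def hardyMean (n : ℕ) (p : ℝ) (f : Vec n → Vec n) (r : ℝ) : ℝ≥0∞ :=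
  (sphMeasure n (unitSphere n))⁻¹ *
    ∫⁻ ω, ENNReal.ofReal (‖f (r • ω)‖ ^ p) ∂(sphMeasure n)

/-- The Hardy `H^p` norm of `f` on the unit ball. -/
def hardyNorm (n : ℕ) (p : ℝ) (f : Vec n → Vec n) : ℝ≥0∞ :=
  (⨆ r ∈ Set.Ioo (0 : ℝ) 1, hardyMean n p f r) ^ (1 / p)

/-- `f` belongs to the Hardy space `H^p`. -/
def MemHp (n : ℕ) (p : ℝ) (f : Vec n → Vec n) : Prop := hardyNorm n p f < ⊤

/-- The `L^p(σ)` norm of a boundary function on the unit sphere. -/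
def lpSphere (n : ℕ) (p : ℝ) (g : Vec n → Vec n) : ℝ≥0∞ :=
  (∫⁻ ω, ENNReal.ofReal (‖g ω‖ ^ p) ∂(sphMeasure n)) ^ (1 / p)

/-- The `L^p(σ)` norm of the non-tangential maximal function `f*`. -/
def ntMaxLp (n : ℕ) (κ p : ℝ) (f : Vec n → Vec n) : ℝ≥0∞ :=
  (∫⁻ ω, (ntMax n κ f ω) ^ p ∂(sphMeasure n)) ^ (1 / p)

/-- `μ` is a Carleson measure on the unit ball with constant `c`. -/
def IsCarleson (n : ℕ) (c : ℝ) (μ : Measure (Vec n)) : Prop :=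
  ∀ ω ∈ unitSphere n, ∀ r : ℝ, 0 < r →
    μ (unitBall n ∩ Metric.ball ω r) ≤ ENNReal.ofReal c * ENNReal.ofReal r ^ ((n : ℝ) - 1)

/-- `μ` is an `α`-Carleson measure on the unit ball with constant `γ`. -/
def IsAlphaCarleson (n : ℕ) (α γ : ℝ) (μ : Measure (Vec n)) : Prop :=
  ∀ ω ∈ unitSphere n, ∀ r : ℝ, 0 < r →
    μ (unitBall n ∩ Metric.ball ω r) ≤
      ENNReal.ofReal γ * ENNReal.ofReal r ^ (α * ((n : ℝ) - 1))

/-- A set on which a `1`-Lipschitz map into `ℝᵐ` is bi-Lipschitz is upper `m`-Ahlfors regular. -/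
lemma hausdorffMeasure_inter_ball_le {X : Type*} [MetricSpace X] [MeasurableSpace X]
    [BorelSpace X] {m : ℕ} (φ : X → Fin m → ℝ) {P : Set X} {L : ℝ≥0}
    (h₁ : ∀ x y, dist (φ x) (φ y) ≤ dist x y)
    (h₂ : ∀ x ∈ P, ∀ y ∈ P, dist x y ≤ L * dist (φ x) (φ y)) (z : X) {ρ : ℝ} (hρ : 0 < ρ) :
    μH[(m : ℝ)] (P ∩ ball z ρ) ≤ ENNReal.ofReal ((L : ℝ) ^ m * (2 * ρ) ^ m) := by
  rcases (P ∩ ball z ρ).eq_empty_or_nonempty with h | ⟨x₀, hx₀⟩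
  · simp [h]
  have : Nonempty X := ⟨x₀⟩
  set A := P ∩ ball z ρ with hA
  have hinj : InjOn φ A := by
    intro x hx y hy hxy
    have := h₂ x hx.1 y hy.1
    rw [hxy, dist_self, mul_zero] at this
    exact dist_le_zero.1 this
  have hleft : LeftInvOn (Function.invFunOn φ A) φ A := hinj.leftInvOn_invFunOn
  have hlip : LipschitzOnWith L (Function.invFunOn φ A) (φ '' A) := by
    refine LipschitzOnWith.of_dist_le_mul ?_
    rintro _ ⟨x, hx, rfl⟩ _ ⟨y, hy, rfl⟩
    rw [hleft hx, hleft hy]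
    exact h₂ x hx.1 y hy.1
  have himg : φ '' A ⊆ ball (φ z) ρ := by
    rintro _ ⟨x, hx, rfl⟩
    exact (h₁ x z).trans_lt hx.2
  have hvol : μH[(m : ℝ)] (φ '' A) ≤ ENNReal.ofReal ((2 * ρ) ^ m) := by
    have h := hausdorffMeasure_pi_real (ι := Fin m)
    rw [Fintype.card_fin] at h
    rw [h]
    refine (measure_mono himg).trans ?_
    rw [Real.volume_pi_ball _ hρ, Fintype.card_fin]
  have h := hlip.hausdorffMeasure_image_le (d := (m : ℝ)) (by positivity)
  rw [hleft.image_image] at h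
  refine h.trans ?_
  rw [ENNReal.ofReal_mul (by positivity), ENNReal.ofReal_pow (by positivity),
    ENNReal.ofReal_coe_nnreal, ENNReal.rpow_natCast]
  gcongr

/-- The coordinate projection forgetting the `i`-th coordinate is bi-Lipschitz on the part of the
unit sphere where the `i`-th coordinate has a fixed sign and is bounded away from `0`. -/
lemma dist_le_mul_dist_succAbove {m : ℕ} (i : Fin (m + 1)) {s : ℝ} (hs : s ^ 2 = 1)
    {x y : Vec (m + 1)} (hx : ‖x‖ = 1) (hy : ‖y‖ = 1) (hxi : 1 ≤ (m + 1) * (s * x i))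
    (hyi : 1 ≤ (m + 1) * (s * y i)) :
    dist x y ≤ ((m * (m + 1) + m : ℕ) : ℝ≥0) *
      dist (fun j => x (i.succAbove j)) (fun j => y (i.succAbove j)) := by
  set δ := dist (fun j => x (i.succAbove j)) (fun j => y (i.succAbove j)) with hδ
  have hδ0 : 0 ≤ δ := dist_nonneg
  have hδj : ∀ j, |x (i.succAbove j) - y (i.succAbove j)| ≤ δ := fun j => by
    simpa [Real.dist_eq] using
      dist_le_pi_dist (fun j => x (i.succAbove j)) (fun j => y (i.succAbove j)) j
  have hcoord : ∀ (v : Vec (m + 1)) j, ‖v‖ = 1 → |v j| ≤ 1 := fun v j hv => by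
    simpa [hv] using PiLp.norm_apply_le v j
  have hx2 : x i ^ 2 + ∑ j, x (i.succAbove j) ^ 2 = 1 := by
    rw [← Fin.sum_univ_succAbove (fun j => x j ^ 2) i, ← EuclideanSpace.real_norm_sq_eq, hx,
      one_pow]
  have hy2 : y i ^ 2 + ∑ j, y (i.succAbove j) ^ 2 = 1 := by
    rw [← Fin.sum_univ_succAbove (fun j => y j ^ 2) i, ← EuclideanSpace.real_norm_sq_eq, hy,
      one_pow]
  have hsum : |∑ j, (x (i.succAbove j) ^ 2 - y (i.succAbove j) ^ 2)| ≤ m * (2 * δ) := by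
    refine (Finset.abs_sum_le_sum_abs _ _).trans ?_
    refine (Finset.sum_le_card_nsmul _ _ (2 * δ) fun j _ => ?_).trans (by simp)
    rw [sq_sub_sq, abs_mul]
    have h1 := abs_add_le (x (i.succAbove j)) (y (i.succAbove j))
    have h2 := hcoord x (i.succAbove j) hx
    have h3 := hcoord y (i.succAbove j) hy
    exact mul_le_mul (by linarith) (hδj j) (abs_nonneg _) (by norm_num)
  rw [Finset.sum_sub_distrib] at hsum
  have hkey : |x i - y i| * |x i + y i| ≤ m * (2 * δ) := by
    have h1 : -((x i - y i) * (x i + y i)) =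
        ∑ j, x (i.succAbove j) ^ 2 - ∑ j, y (i.succAbove j) ^ 2 := by
      linear_combination hy2 - hx2
    rwa [← abs_mul, ← abs_neg, h1]
  have hs1 : |s| = 1 := by
    rw [← abs_one, ← sq_eq_sq_iff_abs_eq_abs, hs, one_pow]
  have hlow : 2 ≤ (m + 1) * |x i + y i| := by
    have h1 : s * (x i + y i) ≤ |x i + y i| := by
      refine (le_abs_self _).trans ?_
      rw [abs_mul, hs1, one_mul]
    have h2 : (m + 1 : ℝ) * (s * (x i + y i)) ≤ (m + 1) * |x i + y i| := by gcongr
    linarith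
  have hi : |x i - y i| ≤ m * (m + 1) * δ := by
    have h1 : |x i - y i| * 2 ≤ |x i - y i| * ((m + 1) * |x i + y i|) := by gcongr
    have h2 : (m + 1 : ℝ) * (|x i - y i| * |x i + y i|) ≤ (m + 1) * (m * (2 * δ)) := by gcongr
    linarith
  have hrest : ∑ j, (x (i.succAbove j) - y (i.succAbove j)) ^ 2 ≤ m * δ ^ 2 := by
    refine (Finset.sum_le_card_nsmul _ _ (δ ^ 2) fun j _ => ?_).trans (by simp)
    exact sq_le_sq' (by linarith [(abs_le.1 (hδj j)).1]) (abs_le.1 (hδj j)).2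
  have hi2 : (x i - y i) ^ 2 ≤ (m * (m + 1) * δ) ^ 2 :=
    sq_le_sq' (by linarith [(abs_le.1 hi).1]) (abs_le.1 hi).2
  have hmm : (m : ℝ) ≤ m ^ 2 := by exact_mod_cast Nat.le_self_pow two_ne_zero m
  rw [dist_eq_norm]
  push_cast
  refine abs_le_of_sq_le_sq' ?_ (by positivity) |>.2
  rw [EuclideanSpace.real_norm_sq_eq, Fin.sum_univ_succAbove _ i]
  simp only [PiLp.sub_apply]
  have h3 : (m : ℝ) * δ ^ 2 ≤ m ^ 2 * δ ^ 2 := by gcongr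
  have h4 : 0 ≤ (m * (m + 1) * δ) * (m * δ) := by positivity
  nlinarith

/-- The surface measure of the unit sphere is upper Ahlfors regular. -/
lemma exists_sphMeasure_ball_le (m : ℕ) : ∃ M : ℝ, 0 < M ∧ ∀ (z : Vec (m + 1)) (ρ : ℝ), 0 < ρ →
    sphMeasure (m + 1) (ball z ρ) ≤ ENNReal.ofReal (M * ρ ^ m) := by
  set L : ℝ≥0 := ((m * (m + 1) + m : ℕ) : ℝ≥0) with hL
  let σ : Bool → ℝ := fun b => if b then 1 else -1
  let P : Fin (m + 1) × Bool → Set (Vec (m + 1)) := fun k =>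
    {x | ‖x‖ = 1 ∧ 1 ≤ (m + 1) * (σ k.2 * x k.1)}
  have hcover : unitSphere (m + 1) ⊆ ⋃ k, P k := by
    intro x hx
    have hx1 : ‖x‖ = 1 := by simpa [unitSphere] using hx
    by_contra hcon
    simp only [mem_iUnion, not_exists] at hcon
    have hlt : ∀ i, (m + 1) * |x i| < 1 := fun i => by
      have h1 := hcon (i, true)
      have h2 := hcon (i, false)
      simp only [P, σ, mem_ofPred_eq, hx1, true_and, not_le, if_true, one_mul,
        Bool.false_eq_true, if_false] at h1 h2
      rcases abs_cases (x i) with h | h <;> rw [h.1] <;> linarith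
    have hsq : ∑ i, x i ^ 2 < ∑ _i : Fin (m + 1), (1 / (m + 1) : ℝ) := by
      refine Finset.sum_lt_sum_of_nonempty Finset.univ_nonempty fun i _ => ?_
      have hle : |x i| ≤ 1 := by simpa [hx1] using PiLp.norm_apply_le x i
      rw [lt_div_iff₀ (by positivity), ← sq_abs]
      have h0 := abs_nonneg (x i)
      have := hlt i
      nlinarith
    rw [← EuclideanSpace.real_norm_sq_eq, hx1] at hsq
    simp only [Finset.sum_const, Finset.card_univ, Fintype.card_fin, nsmul_eq_mul] at hsq
    push_cast at hsq
    rw [mul_one_div_cancel (by positivity)] at hsq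
    norm_num at hsq
  refine ⟨2 * (m + 1) * ((L : ℝ) ^ m * 2 ^ m) + 1, by positivity, fun z ρ hρ => ?_⟩
  have hpiece : ∀ k, μH[(m : ℝ)] (P k ∩ ball z ρ) ≤
      ENNReal.ofReal ((L : ℝ) ^ m * (2 * ρ) ^ m) := fun k => by
    refine hausdorffMeasure_inter_ball_le (fun x j => x (k.1.succAbove j)) ?_ ?_ z hρ
    · intro x y
      refine (dist_pi_le_iff dist_nonneg).2 fun j => ?_
      rw [dist_eq_norm x y, Real.dist_eq]
      simpa using PiLp.norm_apply_le (x - y) (k.1.succAbove j)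
    · intro x hx y hy
      refine dist_le_mul_dist_succAbove k.1 (s := σ k.2) ?_ hx.1 hy.1 hx.2 hy.2
      rcases k with ⟨i, b⟩
      cases b <;> simp [σ]
  have hsub : ball z ρ ∩ unitSphere (m + 1) ⊆ ⋃ k, P k ∩ ball z ρ := by
    intro x hx
    obtain ⟨k, hk⟩ := mem_iUnion.1 (hcover hx.2)
    exact mem_iUnion.2 ⟨k, hk, hx.1⟩
  rw [sphMeasure, Measure.restrict_apply measurableSet_ball]
  have hcast : ((m + 1 : ℕ) : ℝ) - 1 = m := by push_cast; ring
  rw [hcast]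
  refine (measure_mono hsub).trans ((measure_iUnion_fintype_le _ _).trans ?_)
  refine (Finset.sum_le_sum fun k _ => hpiece k).trans ?_
  rw [← ENNReal.ofReal_sum_of_nonneg fun _ _ => by positivity]
  refine ENNReal.ofReal_le_ofReal ?_
  simp only [Finset.sum_const, Finset.card_univ, Fintype.card_prod, Fintype.card_fin,
    Fintype.card_bool, nsmul_eq_mul]
  push_cast
  rw [mul_pow]
  have : 0 < ρ ^ m := by positivity
  nlinarith

/-- The integral of `‖x - a‖ ^ (-q)` against an upper `m`-regular measure supported at distance at
least `r` from `a`. -/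
lemma exists_lintegral_norm_sub_rpow_le {m : ℕ} {q M : ℝ} (hq : (m : ℝ) < q) (hM : 0 < M) :
    ∃ M' : ℝ, 0 < M' ∧ ∀ {E : Type} [NormedAddCommGroup E] [MeasurableSpace E] [BorelSpace E]
      (ν : Measure E), (∀ (z : E) (ρ : ℝ), 0 < ρ → ν (ball z ρ) ≤ ENNReal.ofReal (M * ρ ^ m)) →
      ∀ (a : E) (r : ℝ), 0 < r → (∀ᵐ x ∂ν, r ≤ ‖x - a‖) →
        ∫⁻ x, ENNReal.ofReal (‖x - a‖ ^ (-q)) ∂ν ≤ ENNReal.ofReal (M' * r ^ (m - q)) := by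
  set θ : ℝ := 2 ^ (m - q) with hθ
  have hθ0 : 0 < θ := by positivity
  have hθ1 : θ < 1 := Real.rpow_lt_one_of_one_lt_of_neg (by norm_num) (by linarith)
  have hsub : 0 < (1 - θ)⁻¹ := inv_pos.2 (by linarith)
  refine ⟨M * 2 ^ m * (1 - θ)⁻¹, by positivity, ?_⟩
  intro E _ _ _ ν hν a r hr hae
  have hpt : ∀ᵐ x ∂ν, ENNReal.ofReal (‖x - a‖ ^ (-q)) ≤
      ∑' k : ℕ, (ball a (2 ^ (k + 1) * r)).indicator
        (fun _ => ENNReal.ofReal ((2 ^ k * r) ^ (-q))) x := by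
    filter_upwards [hae] with x hx
    obtain ⟨k, hk1, hk2⟩ := exists_nat_pow_near (x := ‖x - a‖ / r) (y := (2 : ℝ))
      ((one_le_div hr).2 hx) (by norm_num)
    rw [le_div_iff₀ hr] at hk1
    rw [div_lt_iff₀ hr] at hk2
    refine le_trans ?_ (ENNReal.le_tsum k)
    rw [indicator_of_mem (by simpa [dist_eq_norm] using hk2)]
    refine ENNReal.ofReal_le_ofReal ?_
    exact Real.rpow_le_rpow_of_nonpos (by positivity) hk1
      (by have : (0 : ℝ) ≤ m := by positivity
          linarith)
  refine (lintegral_mono_ae hpt).trans ?_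
  rw [lintegral_tsum fun k => (measurable_const.indicator measurableSet_ball).aemeasurable]
  have hterm : ∀ k : ℕ, ∫⁻ x, (ball a (2 ^ (k + 1) * r)).indicator
        (fun _ => ENNReal.ofReal ((2 ^ k * r) ^ (-q))) x ∂ν ≤
      ENNReal.ofReal (M * 2 ^ m * r ^ (m - q) * θ ^ k) := fun k => by
    rw [lintegral_indicator_const measurableSet_ball]
    refine (mul_le_mul_right (hν a _ (by positivity)) _).trans ?_
    rw [← ENNReal.ofReal_mul (by positivity)]
    refine ENNReal.ofReal_le_ofReal (le_of_eq ?_)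
    have e1 : (2 : ℝ) ^ (k + 1) * r = 2 * (2 ^ k * r) := by ring
    have e2 : (2 ^ k * r : ℝ) ^ (-q) * (2 ^ k * r) ^ m = (2 ^ k * r) ^ (m - q) := by
      rw [← Real.rpow_natCast _ m, ← Real.rpow_add (by positivity)]
      ring_nf
    have e3 : (2 ^ k * r : ℝ) ^ (m - q) = θ ^ k * r ^ (m - q) := by
      rw [Real.mul_rpow (by positivity) hr.le, hθ, ← Real.rpow_natCast, ← Real.rpow_mul (by norm_num),
        ← Real.rpow_natCast, ← Real.rpow_mul (by norm_num), mul_comm (k : ℝ)]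
    rw [e1, mul_pow]
    linear_combination (M * 2 ^ m) * (e2.trans e3)
  refine (ENNReal.tsum_le_tsum hterm).trans ?_
  rw [← ENNReal.ofReal_tsum_of_nonneg (fun k => by positivity)
    ((summable_geometric_of_lt_one hθ0.le hθ1).mul_left _), tsum_mul_left,
    tsum_geometric_of_lt_one hθ0.le hθ1]
  exact ENNReal.ofReal_le_ofReal (le_of_eq (by ring))

section Mobius

variable {n : ℕ}

lemma mobius_denom_eq {x : Vec n} (hx0 : x ≠ 0) (y : Vec n) :
    ‖x‖ ^ 2 * ‖y - (‖x‖ ^ 2)⁻¹ • x‖ ^ 2 =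
      ‖y - x‖ ^ 2 + (1 - ‖x‖ ^ 2) * (1 - ‖y‖ ^ 2) := by
  have hne : ‖x‖ ≠ 0 := norm_ne_zero_iff.2 hx0
  rw [norm_sub_sq_real, norm_sub_sq_real, inner_smul_right, norm_smul, norm_inv,
    Real.norm_of_nonneg (by positivity)]
  field_simp
  ring

lemma norm_mobius_num_sq (x y : Vec n) :
    ‖(1 - ‖x‖ ^ 2) • (y - x) - ‖y - x‖ ^ 2 • x‖ ^ 2 =
      ‖y - x‖ ^ 2 * (‖y - x‖ ^ 2 + (1 - ‖x‖ ^ 2) * (1 - ‖y‖ ^ 2)) := by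
  have h1 : ‖y‖ ^ 2 = ‖y - x‖ ^ 2 + 2 * inner ℝ (y - x) x + ‖x‖ ^ 2 := by
    rw [← norm_add_sq_real, sub_add_cancel]
  rw [norm_sub_sq_real, norm_smul, norm_smul, inner_smul_left, inner_smul_right, mul_pow, mul_pow,
    Real.norm_eq_abs, Real.norm_eq_abs, sq_abs, sq_abs, h1]
  simp only [conj_trivial]
  ring

lemma norm_mobiusT_lt_one {x y : Vec n} (hx : ‖x‖ < 1) (hy : ‖y‖ < 1) : ‖mobiusT n x y‖ < 1 := by
  rw [mobiusT]
  split_ifs with hx0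
  · exact hy
  have hpos : 0 < (1 - ‖x‖ ^ 2) * (1 - ‖y‖ ^ 2) := by
    have h1 : ‖x‖ ^ 2 < 1 := by nlinarith [norm_nonneg x]
    have h2 : ‖y‖ ^ 2 < 1 := by nlinarith [norm_nonneg y]
    exact mul_pos (by linarith) (by linarith)
  rw [mobius_denom_eq hx0]
  set D := ‖y - x‖ ^ 2 + (1 - ‖x‖ ^ 2) * (1 - ‖y‖ ^ 2) with hD
  have hDpos : 0 < D := by positivity
  rw [norm_smul, norm_inv, Real.norm_of_nonneg hDpos.le, inv_mul_lt_iff₀ hDpos, mul_one]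
  refine lt_of_pow_lt_pow_left₀ 2 hDpos.le ?_
  rw [norm_mobius_num_sq, ← hD, sq D]
  exact mul_lt_mul_of_pos_right (by linarith) hDpos

lemma inv_normSq_smul_injective {E : Type*} [NormedAddCommGroup E] [NormedSpace ℝ E] :
    Function.Injective fun v : E => (‖v‖ ^ 2)⁻¹ • v := by
  have hinv : Function.Involutive fun v : E => (‖v‖ ^ 2)⁻¹ • v := by
    intro v
    rcases eq_or_ne v 0 with rfl | hv
    · simp
    have hne : ‖v‖ ≠ 0 := norm_ne_zero_iff.2 hv
    simp only [norm_smul, norm_inv, norm_pow, norm_norm, smul_smul]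
    convert one_smul ℝ v using 2
    field_simp
  exact hinv.injective

lemma mobiusT_injOn {x : Vec n} (hx : ‖x‖ < 1) : InjOn (mobiusT n x) (ball 0 1) := by
  rcases eq_or_ne x 0 with rfl | hx0
  · intro y _ z _ h
    simpa [mobiusT] using h
  have hA : 0 < 1 - ‖x‖ ^ 2 := by nlinarith [norm_nonneg x]
  have hval : ∀ y, mobiusT n x y = (‖y - x‖ ^ 2 + (1 - ‖x‖ ^ 2) * (1 - ‖y‖ ^ 2))⁻¹ •
      ((1 - ‖x‖ ^ 2) • (y - x) - ‖y - x‖ ^ 2 • x) := fun y => by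
    rw [mobiusT, if_neg hx0, mobius_denom_eq hx0]
  have hDpos : ∀ y ∈ ball (0 : Vec n) 1, 0 < ‖y - x‖ ^ 2 + (1 - ‖x‖ ^ 2) * (1 - ‖y‖ ^ 2) := by
    intro y hy
    have hy1 : ‖y‖ < 1 := by simpa using hy
    have : 0 < 1 - ‖y‖ ^ 2 := by nlinarith [norm_nonneg y]
    positivity
  have hzero : ∀ y ∈ ball (0 : Vec n) 1, mobiusT n x y = 0 ↔ y = x := by
    intro y hy
    have hD := hDpos y hy
    rw [hval, smul_eq_zero_iff_right (inv_ne_zero hD.ne'), ← norm_eq_zero, ← sq_eq_zero_iff,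
      norm_mobius_num_sq, mul_eq_zero, or_iff_left hD.ne', sq_eq_zero_iff, norm_eq_zero,
      sub_eq_zero]
  have hinv : ∀ y ∈ ball (0 : Vec n) 1, y ≠ x → mobiusT n x y =
      (‖(1 - ‖x‖ ^ 2) • (‖y - x‖ ^ 2)⁻¹ • (y - x) - x‖ ^ 2)⁻¹ •
        ((1 - ‖x‖ ^ 2) • (‖y - x‖ ^ 2)⁻¹ • (y - x) - x) := by
    intro y hy hyx
    have hd : ‖y - x‖ ≠ 0 := norm_ne_zero_iff.2 (sub_ne_zero.2 hyx)
    have hD := (hDpos y hy).ne'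
    have hw : (1 - ‖x‖ ^ 2) • (‖y - x‖ ^ 2)⁻¹ • (y - x) - x =
        (‖y - x‖ ^ 2)⁻¹ • ((1 - ‖x‖ ^ 2) • (y - x) - ‖y - x‖ ^ 2 • x) := by
      rw [smul_sub (‖y - x‖ ^ 2)⁻¹ (_ • _), smul_smul _ (‖y - x‖ ^ 2), inv_mul_cancel₀ (pow_ne_zero 2 hd), one_smul,
        smul_comm]
    rw [hw, norm_smul, mul_pow, norm_mobius_num_sq, norm_inv, norm_pow, norm_norm, smul_smul, hval]
    congr 1
    field_simp
  intro y hy z hz h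
  by_cases hyx : y = x
  · rw [hyx, eq_comm, ← hzero z hz, ← h, hzero y hy, hyx]
  have hzx : z ≠ x := fun hzx => hyx ((hzero y hy).1 (h.trans ((hzero z hz).2 hzx)))
  rw [hinv y hy hyx, hinv z hz hzx] at h
  have h1 := sub_left_injective (inv_normSq_smul_injective h)
  have h2 := smul_right_injective _ hA.ne' h1
  exact sub_left_injective (inv_normSq_smul_injective h2)

end Mobius

section RadialStretch

/-- The radial power map `v ↦ ‖v‖ ^ (-β - 1) • v`, which satisfies `‖h v‖ = ‖v‖ ^ (-β)`. -/
def radialPow {E : Type*} [NormedAddCommGroup E] [NormedSpace ℝ E] (β : ℝ) (v : E) : E :=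
  (‖v‖ ^ 2) ^ (-(β + 1) / 2) • v

/-- The derivative of the radial power map, up to the factor `‖v‖ ^ (-β - 1)`. -/
def radialDeriv {E : Type*} [NormedAddCommGroup E] [InnerProductSpace ℝ E] (β : ℝ) (v : E) :
    E →L[ℝ] E :=
  ContinuousLinearMap.id ℝ E + ((-(β + 1) / ‖v‖ ^ 2) • innerSL ℝ v).smulRight v

variable {E : Type*} [NormedAddCommGroup E] [InnerProductSpace ℝ E] {β : ℝ} {v : E}

lemma norm_radialPow (hv : v ≠ 0) : ‖radialPow β v‖ = ‖v‖ ^ (-β) := by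
  have h0 : 0 < ‖v‖ := norm_pos_iff.2 hv
  rw [radialPow, norm_smul, Real.norm_of_nonneg (by positivity), ← Real.rpow_natCast,
    ← Real.rpow_mul h0.le, ← Real.rpow_add_one h0.ne']
  congr 1
  push_cast
  ring

lemma radialPow_injOn (hβ : β ≠ 0) : InjOn (radialPow β) {v : E | v ≠ 0} := by
  intro v hv w hw h
  have hn : ‖v‖ ^ (-β) = ‖w‖ ^ (-β) := by rw [← norm_radialPow hv, h, norm_radialPow hw]
  have hn' : ‖v‖ = ‖w‖ :=
    (Real.rpow_left_inj (norm_nonneg _) (norm_nonneg _) (neg_ne_zero.2 hβ)).1 hn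
  have h0 : 0 < ‖w‖ := norm_pos_iff.2 hw
  simp only [radialPow, hn'] at h
  exact smul_right_injective E (by positivity) h

lemma hasFDerivAt_radialPow (hv : v ≠ 0) :
    HasFDerivAt (radialPow β) ((‖v‖ ^ 2) ^ (-(β + 1) / 2) • radialDeriv β v) v := by
  have h0 : 0 < ‖v‖ ^ 2 := by
    have := norm_pos_iff.2 hv
    positivity
  have h1 : HasFDerivAt (fun w : E => ‖w‖ ^ 2) (2 • innerSL ℝ v) v :=
    (hasStrictFDerivAt_norm_sq v).hasFDerivAt
  have h2 := (h1.rpow_const (p := -(β + 1) / 2) (Or.inl h0.ne')).smul (hasFDerivAt_id v)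
  refine HasFDerivAt.congr_fderiv (f := radialPow β) h2 ?_
  ext1 u
  simp [radialDeriv, smul_smul, Real.rpow_sub_one h0.ne']
  field_simp

lemma norm_radialDeriv_le (hβ : 1 ≤ β) (hv : v ≠ 0) : ‖radialDeriv β v‖ ≤ β := by
  refine ContinuousLinearMap.opNorm_le_bound _ (by linarith) fun u => ?_
  have h0 : 0 < ‖v‖ := norm_pos_iff.2 hv
  refine le_of_sq_le_sq ?_ (by positivity)
  have hval : radialDeriv β v u = u + (-(β + 1) / ‖v‖ ^ 2 * inner ℝ v u) • v := by
    simp [radialDeriv]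
  have hcs : (inner ℝ v u) ^ 2 ≤ ‖v‖ ^ 2 * ‖u‖ ^ 2 := by
    rw [← mul_pow, ← sq_abs]
    gcongr
    exact abs_real_inner_le_norm v u
  have hsq : ‖radialDeriv β v u‖ ^ 2 =
      ‖u‖ ^ 2 + (β ^ 2 - 1) * ((inner ℝ v u) ^ 2 / ‖v‖ ^ 2) := by
    rw [hval, norm_add_sq_real, inner_smul_right, norm_smul, mul_pow, Real.norm_eq_abs, sq_abs,
      real_inner_comm]
    field_simp
    ring
  have hdiv : (inner ℝ v u) ^ 2 / ‖v‖ ^ 2 ≤ ‖u‖ ^ 2 := by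
    rw [div_le_iff₀ (by positivity)]
    linarith
  have hb : 0 ≤ β ^ 2 - 1 := by nlinarith
  rw [hsq]
  nlinarith [mul_le_mul_of_nonneg_left hdiv hb]

lemma det_radialDeriv [FiniteDimensional ℝ E] (hv : v ≠ 0) : (radialDeriv β v).det = -β := by
  have h : ((radialDeriv β v : E →L[ℝ] E) : E →ₗ[ℝ] E) =
      LinearMap.transvection (((-(β + 1) / ‖v‖ ^ 2) • innerSL ℝ v : E →L[ℝ] ℝ) : E →ₗ[ℝ] ℝ) v := by
    ext u
    simp [radialDeriv, LinearMap.transvection.apply]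
  have h0 : ‖v‖ ≠ 0 := norm_ne_zero_iff.2 hv
  rw [ContinuousLinearMap.det, h, LinearMap.transvection.det]
  simp
  field_simp
  ring

/-- Composition of a reflection with the radial power map centred at `a`. -/
lemma exists_quasiregular_radial (m : ℕ) {β : ℝ} (hβ : 1 ≤ β) (a : Vec (m + 1)) :
    ∃ f : Vec (m + 1) → Vec (m + 1),
      (∀ x, x ≠ a → DifferentiableAt ℝ f x ∧
        ‖fderiv ℝ f x‖ ^ (m + 1) ≤ β ^ m * (fderiv ℝ f x).det) ∧
      InjOn f {x | x ≠ a} ∧ ∀ x, x ≠ a → ‖f x‖ = ‖x - a‖ ^ (-β) := by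
  set e : Vec (m + 1) := EuclideanSpace.single 0 1 with he
  have he0 : e ≠ 0 := by simp [he]
  set R : Vec (m + 1) ≃ₗᵢ[ℝ] Vec (m + 1) := (ℝ ∙ e)ᗮ.reflection with hR
  have hRdet : LinearMap.det R.toLinearMap = -1 := by
    rw [hR, Submodule.det_reflection, Submodule.orthogonal_orthogonal, finrank_span_singleton he0,
      pow_one]
  refine ⟨fun x => R (radialPow β (x - a)), fun x hx => ?_, fun x hx y hy h => ?_, fun x hx => ?_⟩
  · have hv : x - a ≠ 0 := sub_ne_zero.2 hx
    set c : ℝ := (‖x - a‖ ^ 2) ^ (-(β + 1) / 2) with hc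
    have hc0 : 0 ≤ c := by positivity
    have hd : HasFDerivAt (fun x => R (radialPow β (x - a)))
        ((R : Vec (m + 1) →L[ℝ] Vec (m + 1)).comp (c • radialDeriv β (x - a))) x := by
      have h1 := (hasFDerivAt_radialPow (β := β) hv).comp x ((hasFDerivAt_id x).sub_const a)
      exact (R : Vec (m + 1) →L[ℝ] Vec (m + 1)).hasFDerivAt.comp x h1
    refine ⟨hd.differentiableAt, ?_⟩
    rw [hd.fderiv]
    have hnorm : ‖(R : Vec (m + 1) →L[ℝ] Vec (m + 1)).comp (c • radialDeriv β (x - a))‖ ≤ c * β := by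
      refine ContinuousLinearMap.opNorm_le_bound _ (by positivity) fun u => ?_
      have h1 := (radialDeriv β (x - a)).le_of_opNorm_le (norm_radialDeriv_le hβ hv) u
      simp only [ContinuousLinearMap.comp_apply, smul_apply]
      change ‖R (c • radialDeriv β (x - a) u)‖ ≤ _
      rw [R.norm_map, norm_smul, Real.norm_of_nonneg hc0, mul_assoc]
      gcongr
    have hdet : ((R : Vec (m + 1) →L[ℝ] Vec (m + 1)).comp (c • radialDeriv β (x - a))).det =
        c ^ (m + 1) * β := by
      have h1 : (((R : Vec (m + 1) →L[ℝ] Vec (m + 1)).comp (c • radialDeriv β (x - a)) :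
          Vec (m + 1) →L[ℝ] Vec (m + 1)) : Vec (m + 1) →ₗ[ℝ] Vec (m + 1)) =
          R.toLinearMap ∘ₗ (c • (radialDeriv β (x - a) : Vec (m + 1) →ₗ[ℝ] Vec (m + 1))) := rfl
      have h2 := det_radialDeriv (β := β) hv
      rw [ContinuousLinearMap.det] at h2 ⊢
      rw [h1, LinearMap.det_comp, LinearMap.det_smul, h2, hRdet, finrank_euclideanSpace_fin]
      ring
    rw [hdet]
    refine (pow_le_pow_left₀ (norm_nonneg _) hnorm _).trans (le_of_eq ?_)
    ring
  · exact sub_left_injective (radialPow_injOn (by linarith : β ≠ 0) (sub_ne_zero.2 hx)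
      (sub_ne_zero.2 hy) (R.injective h))
  · rw [R.norm_map, norm_radialPow (sub_ne_zero.2 hx)]

end RadialStretch

/-- A map whose norm is pinched between positive constants on the ball is in the Miniowitz class. -/
lemma inMiniowitz_of_norm_bounds {n : ℕ} {f : Vec n → Vec n} {l u : ℝ} (hl : 0 < l)
    (hlf : ∀ x ∈ unitBall n, l ≤ ‖f x‖) (hfu : ∀ x ∈ unitBall n, ‖f x‖ ≤ u) :
    InMiniowitz n (u / l) 1 f := by
  intro x hx y hy
  have hx1 : ‖-x‖ < 1 := by simpa [unitBall] using hx
  have hy1 : ‖y‖ < 1 := by simpa [unitBall] using hy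
  have hTy : mobiusT n (-x) y ∈ unitBall n := by
    simpa [unitBall] using norm_mobiusT_lt_one hx1 hy1
  have hT0 : mobiusT n (-x) 0 ∈ unitBall n := by
    simpa [unitBall] using norm_mobiusT_lt_one hx1 (y := 0) (by simp)
  have hl1 := hlf _ hTy
  have hl0 := hlf _ hT0
  have hu1 := hfu _ hTy
  have hu0 := hfu _ hT0
  have hu : 0 < u := hl.trans_le (hl0.trans hu0)
  have hf0 := hl.trans_le hl0
  have hy0 := norm_nonneg y
  rw [Real.rpow_one, Real.rpow_one, inv_div]
  constructor
  · have h1 : (1 - ‖y‖) / (1 + ‖y‖) ≤ 1 := by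
      rw [div_le_one (by positivity)]
      linarith
    calc l / u * ((1 - ‖y‖) / (1 + ‖y‖)) ≤ l / u * 1 := by gcongr
      _ = l / u := mul_one _
      _ ≤ _ := by gcongr
  · have h1 : 1 ≤ (1 + ‖y‖) / (1 - ‖y‖) := by
      rw [le_div_iff₀ (by linarith)]
      linarith
    calc _ ≤ u / l := by gcongr
      _ = u / l * 1 := (mul_one _).symm
      _ ≤ u / l * ((1 + ‖y‖) / (1 - ‖y‖)) := by gcongr

/-- An injective map on the ball satisfies the multiplicity condition. -/
lemma multCond_of_injOn {n : ℕ} {f : Vec n → Vec n} (hf : InjOn f (unitBall n)) :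
    MultCond n 0 1 f := by
  intro x hx r _ hr1 y
  have hx1 : ‖-x‖ < 1 := by simpa [unitBall] using hx
  rw [Real.rpow_zero, div_one, ENNReal.ofReal_one]
  have h : {z ∈ ball (0 : Vec n) r | f (mobiusT n (-x) z) = y}.encard ≤ 1 := by
    refine encard_le_one_iff.2 fun z w hz hw => ?_
    have hz1 := ball_subset_ball hr1.le hz.1
    have hw1 := ball_subset_ball hr1.le hw.1
    refine mobiusT_injOn hx1 hz1 hw1 (hf ?_ ?_ (hz.2.trans hw.2.symm))
    · simpa [unitBall] using norm_mobiusT_lt_one hx1 (by simpa using hz1)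
    · simpa [unitBall] using norm_mobiusT_lt_one hx1 (by simpa using hw1)
  exact_mod_cast h

theorem carleson_measure_converse (n : ℕ) (hn : 2 ≤ n) (K αc κ p : ℝ)
    (hK : 1 ≤ K) (hαc : 1 ≤ αc) (hκ : 0 < κ)
    (hp : ((n : ℝ) - 1) / K ^ (1 / ((n : ℝ) - 1)) < p)
    (μ : Measure (Vec n)) (C : ℝ) (hC : 0 < C)
    (hμ : ∀ f : Vec n → Vec n,
      IsQR n K f → (∀ x ∈ unitBall n, f x ≠ 0) →
      (∃ C₀ α₀ : ℝ, 1 ≤ C₀ ∧ 0 < α₀ ∧ InMiniowitz n C₀ α₀ f) →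
      (∃ a C₁ : ℝ, 0 ≤ a ∧ a < (n : ℝ) - 1 ∧ 0 < C₁ ∧ MultCond n a C₁ f) →
      ∀ g : Vec n → Vec n, (∀ᵐ ω ∂(sphMeasure n), HasNTLimit n κ f ω (g ω)) →
        ∫⁻ x in unitBall n, ENNReal.ofReal (‖f x‖ ^ (αc * p)) ∂μ ≤
          ENNReal.ofReal C * (∫⁻ ω, ENNReal.ofReal (‖g ω‖ ^ p) ∂(sphMeasure n)) ^ αc) :
    ∃ γ : ℝ, 0 < γ ∧ IsAlphaCarleson n αc γ μ := by
  obtain ⟨m, rfl⟩ : ∃ m, n = m + 1 := ⟨n - 1, by omega⟩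
  have hm : 0 < m := by omega
  have hm' : (0 : ℝ) < m := by exact_mod_cast hm
  have hcast : ((m + 1 : ℕ) : ℝ) - 1 = m := by push_cast; ring
  simp only [IsAlphaCarleson, hcast] at *
  set β : ℝ := K ^ (1 / (m : ℝ)) with hβ
  have hβ1 : 1 ≤ β := Real.one_le_rpow hK (by positivity)
  have hβ0 : 0 < β := by linarith
  have hβK : β ^ m = K := by
    rw [hβ, one_div, Real.rpow_inv_natCast_pow (by linarith) hm.ne']
  have hp0 : 0 < p := lt_of_le_of_lt (by positivity) hp
  have hq : (m : ℝ) < β * p := by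
    rw [div_lt_iff₀ hβ0] at hp
    linarith
  have hα0 : 0 < αc := by linarith
  obtain ⟨M, hM, hball⟩ := exists_sphMeasure_ball_le m
  obtain ⟨M', hM', hint⟩ := exists_lintegral_norm_sub_rpow_le hq hM
  refine ⟨C * M' ^ αc * 2 ^ (β * p * αc), by positivity, fun ω hω r hr => ?_⟩
  have hω1 : ‖ω‖ = 1 := by simpa [unitSphere] using hω
  set a : Vec (m + 1) := (1 + r) • ω with ha
  have hna : ‖a‖ = 1 + r := by
    rw [ha, norm_smul, hω1, mul_one, Real.norm_of_nonneg (by positivity)]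
  have hlow : ∀ x : Vec (m + 1), ‖x‖ ≤ 1 → r ≤ ‖x - a‖ := fun x hx => by
    have := norm_sub_norm_le a x
    rw [norm_sub_rev] at this
    linarith
  have hne : ∀ x : Vec (m + 1), ‖x‖ ≤ 1 → x ≠ a := fun x hx hxa => by
    have := hlow x hx
    rw [hxa, sub_self, norm_zero] at this
    linarith
  have hup : ∀ x : Vec (m + 1), ‖x‖ ≤ 1 → ‖x - a‖ ≤ 2 + r := fun x hx => by
    have := norm_sub_le x a
    linarith
  have hBle : ∀ x ∈ unitBall (m + 1), ‖x‖ ≤ 1 := fun x hx => by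
    have : ‖x‖ < 1 := by simpa [unitBall] using hx
    exact this.le
  obtain ⟨f, hfd, hfinj, hfn⟩ := exists_quasiregular_radial m hβ1 a
  have hlf : ∀ x ∈ unitBall (m + 1), (2 + r) ^ (-β) ≤ ‖f x‖ := fun x hx => by
    have hx1 := hBle x hx
    rw [hfn x (hne x hx1)]
    exact Real.rpow_le_rpow_of_nonpos (hr.trans_le (hlow x hx1)) (hup x hx1) (by linarith)
  have hfu : ∀ x ∈ unitBall (m + 1), ‖f x‖ ≤ r ^ (-β) := fun x hx => by
    have hx1 := hBle x hx
    rw [hfn x (hne x hx1)]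
    exact Real.rpow_le_rpow_of_nonpos hr (hlow x hx1) (by linarith)
  have hl : 0 < (2 + r) ^ (-β) := by positivity
  have hfpow : ∀ (x : Vec (m + 1)) (s : ℝ), ‖x‖ ≤ 1 → ‖f x‖ ^ s = ‖x - a‖ ^ (-(β * s)) :=
    fun x s hx => by
      rw [hfn x (hne x hx), ← Real.rpow_mul (norm_nonneg _), neg_mul]
  have hsph : ∀ᵐ x ∂(sphMeasure (m + 1)), ‖x‖ = 1 := by
    filter_upwards [ae_restrict_mem (isClosed_sphere (x := (0 : Vec (m + 1))) (ε := 1)).measurableSet]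
      with x hx
    simpa [unitSphere] using hx
  have hmain := hμ f
    ⟨fun x hx => (hfd x (hne x (hBle x hx))).1.continuousAt.continuousWithinAt,
      fun x hx => (hfd x (hne x (hBle x hx))).1, by
        filter_upwards [ae_restrict_mem (measurableSet_ball (x := (0 : Vec (m + 1))) (ε := 1))]
          with x hx
        rw [← hβK]
        exact (hfd x (hne x (hBle x hx))).2⟩
    (fun x hx => norm_pos_iff.1 (hl.trans_le (hlf x hx)))
    ⟨r ^ (-β) / (2 + r) ^ (-β), 1, by
      rw [one_le_div hl]
      exact Real.rpow_le_rpow_of_nonpos hr (by linarith) (by linarith), one_pos,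
      inMiniowitz_of_norm_bounds hl hlf hfu⟩
    ⟨0, 1, le_rfl, hm', one_pos,
      multCond_of_injOn (hfinj.mono fun x hx => hne x (hBle x hx))⟩
    f (by
      filter_upwards [hsph] with x hx
      exact (hfd x (hne x hx.le)).1.continuousAt.tendsto.mono_left nhdsWithin_le_nhds)
  have hI : ∫⁻ x, ENNReal.ofReal (‖f x‖ ^ p) ∂(sphMeasure (m + 1)) ≤
      ENNReal.ofReal (M' * r ^ (m - β * p)) := by
    refine le_trans (le_of_eq ?_) (hint (sphMeasure (m + 1)) hball a r hr ?_)
    · refine lintegral_congr_ae ?_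
      filter_upwards [hsph] with x hx
      rw [hfpow x p hx.le]
    · filter_upwards [hsph] with x hx
      exact hlow x hx.le
  set A := unitBall (m + 1) ∩ ball ω r with hA
  have hpow0 : 0 < (2 * r) ^ (-(β * (αc * p))) := by positivity
  have hAf : ENNReal.ofReal ((2 * r) ^ (-(β * (αc * p)))) * μ A ≤
      ∫⁻ x in unitBall (m + 1), ENNReal.ofReal (‖f x‖ ^ (αc * p)) ∂μ := by
    rw [← setLIntegral_const]
    refine (setLIntegral_mono' (measurableSet_ball.inter measurableSet_ball) fun x hx => ?_).trans
      (lintegral_mono_set inter_subset_left)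
    have hx1 := hBle x hx.1
    have hxa : ‖x - a‖ ≤ 2 * r := by
      have h1 : x - a = (x - ω) - r • ω := by
        rw [ha]
        module
      have h2 : ‖x - ω‖ < r := by simpa [dist_eq_norm] using hx.2
      have h3 := norm_sub_le (x - ω) (r • ω)
      rw [norm_smul, hω1, mul_one, Real.norm_of_nonneg hr.le] at h3
      rw [h1]
      linarith
    rw [hfpow x _ hx1]
    refine ENNReal.ofReal_le_ofReal
      (Real.rpow_le_rpow_of_nonpos (hr.trans_le (hlow x hx1)) hxa ?_)
    have : 0 < β * (αc * p) := by positivity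
    linarith
  have hfin : ENNReal.ofReal ((2 * r) ^ (-(β * (αc * p)))) * μ A ≤
      ENNReal.ofReal (C * (M' * r ^ (m - β * p)) ^ αc) := by
    refine (hAf.trans hmain).trans ?_
    rw [ENNReal.ofReal_mul hC.le, ← ENNReal.ofReal_rpow_of_nonneg (by positivity) hα0.le]
    gcongr
  rw [mul_comm, ← ENNReal.le_div_iff_mul_le (Or.inl (ENNReal.ofReal_pos.2 hpow0).ne')
    (Or.inl ENNReal.ofReal_ne_top), ← ENNReal.ofReal_div_of_pos hpow0] at hfin
  refine hfin.trans ?_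
  rw [ENNReal.ofReal_rpow_of_pos hr, ← ENNReal.ofReal_mul (by positivity)]
  refine ENNReal.ofReal_le_ofReal (le_of_eq ?_)
  rw [Real.rpow_neg (by positivity), div_inv_eq_mul, Real.mul_rpow hM'.le (by positivity),
    ← Real.rpow_mul hr.le, Real.mul_rpow (by norm_num) hr.le]
  have e1 : r ^ ((m - β * p) * αc) * r ^ (β * (αc * p)) = r ^ (αc * m) := by
    rw [← Real.rpow_add hr]
    ring_nf
  have e2 : (2 : ℝ) ^ (β * (αc * p)) = 2 ^ (β * p * αc) := by ring_nf
  rw [e2, ← e1]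
  ring

end
end

section
/- Let n ≥ 2 and let f : B → ℝⁿ \ {0} be a K-quasiregular mapping in the Miniowitz class (Min) with constants C₀, α, satisfying the multiplicity condition (M) with exponent 0 ≤ a < n−1 and constant C₁. If f ∈ H^p for some 0 < p < n, then ∫₀¹ (1−r)^{n−2} M(r,f)^p dr < ∞, where M(r,f) := sup_{|x|=r} |f(x)|. -/
open MeasureTheory Metric Set Filter
open scoped ENNReal NNReal Topology Classical

noncomputable section

theorem lintegral_eq_lintegral_toSphere {E : Type*} [NormedAddCommGroup E] [NormedSpace ℝ E]
    [MeasurableSpace E] [BorelSpace E] [FiniteDimensional ℝ E] [Nontrivial E]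
    (μ : Measure E) [μ.IsAddHaarMeasure] {h : E → ℝ≥0∞} (hh : Measurable h) :
    ∫⁻ y, h y ∂μ = ∫⁻ ω : sphere (0 : E) 1,
      (∫⁻ r in Ioi (0 : ℝ), ENNReal.ofReal (r ^ (Module.finrank ℝ E - 1)) * h (r • ω.1))
        ∂μ.toSphere := by
  have h0 : MeasurableSet ({(0 : E)}ᶜ : Set E) := (measurableSet_singleton _).compl
  calc ∫⁻ y, h y ∂μ = ∫⁻ y in ({(0 : E)}ᶜ : Set E), h y ∂μ := by
        rw [restrict_compl_singleton]
    _ = ∫⁻ y : ({(0 : E)}ᶜ : Set E), h y.1 ∂(μ.comap (↑)) := by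
        rw [lintegral_subtype_comap h0]
    _ = ∫⁻ x, h (x.2.1 • x.1.1) ∂μ.toSphere.prod (.volumeIoiPow (Module.finrank ℝ E - 1)) := by
        rw [← μ.measurePreserving_homeomorphUnitSphereProd.lintegral_comp_emb
          (Homeomorph.measurableEmbedding _)]
        refine lintegral_congr fun y => ?_
        congr 1
        have : ‖(y : E)‖ ≠ 0 := norm_ne_zero_iff.2 y.2
        simp [smul_smul, this]
    _ = _ := by
        have hm : Measurable fun x : sphere (0 : E) 1 × Ioi (0 : ℝ) => h (x.2.1 • x.1.1) :=
          hh.comp (by fun_prop)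
        rw [lintegral_prod _ hm.aemeasurable]
        refine lintegral_congr fun ω => ?_
        have hm' : Measurable fun r : Ioi (0 : ℝ) => h (r.1 • ω.1) := hh.comp (by fun_prop)
        rw [Measure.volumeIoiPow, lintegral_withDensity_eq_lintegral_mul _ (by fun_prop) hm']
        exact lintegral_subtype_comap measurableSet_Ioi
          (fun r : ℝ => ENNReal.ofReal (r ^ (Module.finrank ℝ E - 1)) * h (r • ω.1))

/-- The part of the shell `a < ‖y‖ < b` lying over a set of directions. -/
def sector {E : Type*} [NormedAddCommGroup E] [NormedSpace ℝ E] (A : Set (sphere (0 : E) 1))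
    (a b : ℝ) : Set E :=
  {y | ∃ ω ∈ A, ∃ r ∈ Ioo a b, y = r • ω.1}

theorem smul_mem_sector_iff {E : Type*} [NormedAddCommGroup E] [NormedSpace ℝ E]
    {A : Set (sphere (0 : E) 1)} {a b r : ℝ} {ω : sphere (0 : E) 1} (ha : 0 ≤ a) (hr : 0 < r) :
    r • ω.1 ∈ sector A a b ↔ ω ∈ A ∧ r ∈ Ioo a b := by
  constructor
  · rintro ⟨ω', hω', r', hr', h⟩
    have h1 : r = r' := by
      have := congrArg norm h
      simpa [norm_smul, abs_of_pos hr, abs_of_nonneg (ha.trans hr'.1.le)] using this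
    subst h1
    have : ω = ω' := Subtype.ext (smul_right_injective E hr.ne' h)
    subst this
    exact ⟨hω', hr'⟩
  · rintro ⟨h1, h2⟩
    exact ⟨ω, h1, r, h2, rfl⟩

theorem measurableSet_sector {E : Type*} [NormedAddCommGroup E] [NormedSpace ℝ E]
    [MeasurableSpace E] [BorelSpace E] [SecondCountableTopology E] {A : Set (sphere (0 : E) 1)}
    (hA : MeasurableSet A) {a b : ℝ} (ha : 0 ≤ a) : MeasurableSet (sector A a b) := by
  have h0 : MeasurableSet ({(0 : E)}ᶜ : Set E) := (measurableSet_singleton _).compl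
  have : sector A a b = Subtype.val '' ((homeomorphUnitSphereProd E) ⁻¹'
      (A ×ˢ (Subtype.val ⁻¹' Ioo a b))) := by
    ext y
    constructor
    · rintro ⟨ω, hω, r, hr, rfl⟩
      have hr0 : 0 < r := ha.trans_lt hr.1
      refine ⟨(homeomorphUnitSphereProd E).symm (ω, ⟨r, hr0⟩), ?_, by simp⟩
      simp only [mem_preimage, Homeomorph.apply_symm_apply]
      exact ⟨hω, hr⟩
    · rintro ⟨z, ⟨h1, h2⟩, rfl⟩
      have hz : ‖z.1‖ ≠ 0 := norm_ne_zero_iff.2 z.2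
      exact ⟨_, h1, _, h2, by simp [smul_smul, hz]⟩
  rw [this]
  refine (MeasurableEmbedding.subtype_coe h0).measurableSet_image.2 ?_
  refine (homeomorphUnitSphereProd E).measurable ?_
  exact hA.prod (measurable_subtype_coe measurableSet_Ioo)

theorem setLIntegral_sector {E : Type*} [NormedAddCommGroup E] [NormedSpace ℝ E]
    [MeasurableSpace E] [BorelSpace E] [FiniteDimensional ℝ E] [Nontrivial E]
    (μ : Measure E) [μ.IsAddHaarMeasure] {A : Set (sphere (0 : E) 1)} (hA : MeasurableSet A)
    {a b : ℝ} (ha : 0 ≤ a) {h : E → ℝ≥0∞} (hh : Measurable h) :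
    ∫⁻ y in sector A a b, h y ∂μ = ∫⁻ ω in A,
      (∫⁻ r in Ioo a b, ENNReal.ofReal (r ^ (Module.finrank ℝ E - 1)) * h (r • ω.1))
        ∂μ.toSphere := by
  rw [← lintegral_indicator (measurableSet_sector hA ha),
    lintegral_eq_lintegral_toSphere μ (hh.indicator (measurableSet_sector hA ha)),
    ← lintegral_indicator hA]
  refine lintegral_congr fun ω => ?_
  by_cases hω : ω ∈ A
  · rw [indicator_of_mem hω, ← lintegral_indicator measurableSet_Ioi,
      ← lintegral_indicator measurableSet_Ioo]
    refine lintegral_congr fun r => ?_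
    by_cases hr : 0 < r
    · have := smul_mem_sector_iff (A := A) (b := b) (ω := ω) ha hr
      by_cases hr' : r ∈ Ioo a b
      · rw [indicator_of_mem (show r ∈ Ioi 0 from hr), indicator_of_mem (this.2 ⟨hω, hr'⟩),
          indicator_of_mem hr']
      · rw [indicator_of_mem (show r ∈ Ioi 0 from hr),
          indicator_of_notMem (fun h => hr' (this.1 h).2), indicator_of_notMem hr', mul_zero]
    · rw [indicator_of_notMem (show r ∉ Ioi 0 from hr), indicator_of_notMem]
      exact fun h => hr (ha.trans_lt h.1)
  · rw [indicator_of_notMem hω, lintegral_eq_zero_iff' ?_]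
    · refine (ae_restrict_iff' measurableSet_Ioi).2 (.of_forall fun r hr => ?_)
      have := smul_mem_sector_iff (A := A) (b := b) (ω := ω) ha hr
      simp only [indicator_of_notMem (fun h => hω (this.1 h).1), mul_zero, Pi.zero_apply]
    · refine Measurable.aemeasurable ?_
      have := (hh.indicator (measurableSet_sector hA ha (b := b)))
      exact Measurable.mul (by fun_prop) (this.comp (by fun_prop))

section SphereCaps

variable {E : Type*} [NormedAddCommGroup E] [NormedSpace ℝ E] [MeasurableSpace E] [BorelSpace E]
  [FiniteDimensional ℝ E] [Nontrivial E] (μ : Measure E) [μ.IsAddHaarMeasure]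

theorem toSphere_closedBall_le (ω₀ : sphere (0 : E) 1) {d : ℝ} (hd : 0 < d) :
    μ.toSphere (closedBall ω₀ d) ≤
      ENNReal.ofReal (2 ^ Module.finrank ℝ E) * μ (closedBall 0 1) *
        ENNReal.ofReal (d ^ (Module.finrank ℝ E - 1)) := by
  have hN : 0 < Module.finrank ℝ E := Module.finrank_pos
  have hsub : sector (closedBall ω₀ d) 1 (1 + d) ⊆ closedBall ω₀.1 (2 * d) := by
    rintro _ ⟨ω, hω, r, hr, rfl⟩
    have h1 : ‖ω.1 - ω₀.1‖ ≤ d := by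
      have := mem_closedBall.1 hω
      rwa [Subtype.dist_eq, dist_eq_norm] at this
    have h2 : ‖ω.1‖ = 1 := by simp
    rw [mem_closedBall, dist_eq_norm]
    calc ‖r • ω.1 - ω₀.1‖ = ‖(r - 1) • ω.1 + (ω.1 - ω₀.1)‖ := by congr 1; module
      _ ≤ ‖(r - 1) • ω.1‖ + ‖ω.1 - ω₀.1‖ := norm_add_le _ _
      _ = (r - 1) + ‖ω.1 - ω₀.1‖ := by
        rw [norm_smul, h2, Real.norm_of_nonneg (by linarith [hr.1]), mul_one]
      _ ≤ 2 * d := by linarith [hr.2]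
  have h1 := measure_mono (μ := μ) hsub
  rw [Measure.addHaar_closedBall' μ _ (by positivity), ← setLIntegral_one,
    setLIntegral_sector μ measurableSet_closedBall zero_le_one measurable_const] at h1
  have h2 : ENNReal.ofReal d * μ.toSphere (closedBall ω₀ d) ≤
      ENNReal.ofReal ((2 * d) ^ Module.finrank ℝ E) * μ (closedBall 0 1) := by
    refine le_trans ?_ h1
    rw [← setLIntegral_const]
    refine lintegral_mono fun ω => ?_
    calc ENNReal.ofReal d = ∫⁻ r in Ioo 1 (1 + d), 1 := by simp
      _ ≤ _ := by
        refine setLIntegral_mono' measurableSet_Ioo fun r hr => ?_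
        rw [mul_one, ENNReal.one_le_ofReal]
        exact one_le_pow₀ hr.1.le
  have h3 : ENNReal.ofReal ((2 * d) ^ Module.finrank ℝ E) * μ (closedBall 0 1) =
      ENNReal.ofReal d * (ENNReal.ofReal (2 ^ Module.finrank ℝ E) * μ (closedBall 0 1) *
        ENNReal.ofReal (d ^ (Module.finrank ℝ E - 1))) := by
    have : (2 * d) ^ Module.finrank ℝ E =
        d * (2 ^ Module.finrank ℝ E * d ^ (Module.finrank ℝ E - 1)) := by
      rw [mul_pow, ← mul_pow_sub_one hN.ne' d]; ring
    rw [this, ENNReal.ofReal_mul hd.le, ENNReal.ofReal_mul (by positivity)]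
    ring
  rw [h3] at h2
  exact (ENNReal.mul_le_mul_iff_right (by simpa using hd) ENNReal.ofReal_ne_top).1 h2

theorem le_toSphere_closedBall (ω₀ : sphere (0 : E) 1) {d : ℝ} (hd : 0 < d) (hd' : d ≤ 1 / 2) :
    ENNReal.ofReal ((1 / 8) ^ Module.finrank ℝ E) * μ (closedBall 0 1) *
        ENNReal.ofReal (d ^ (Module.finrank ℝ E - 1)) ≤ μ.toSphere (closedBall ω₀ d) := by
  have hN : 0 < Module.finrank ℝ E := Module.finrank_pos
  have hω₀ : ‖ω₀.1‖ = 1 := by simp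
  have hsub : closedBall ((1 - d / 2) • ω₀.1) (1 / 8 * d) ⊆ sector (closedBall ω₀ d) (1 - d) 1 := by
    intro y hy
    rw [mem_closedBall, dist_eq_norm] at hy
    have e1 : ‖(1 - d / 2) • ω₀.1‖ = 1 - d / 2 := by
      rw [norm_smul, hω₀, Real.norm_of_nonneg (by linarith), mul_one]
    have e2 := abs_le.1 ((abs_norm_sub_norm_le y ((1 - d / 2) • ω₀.1)).trans hy)
    rw [e1] at e2
    have hy0 : 0 < ‖y‖ := by linarith
    refine ⟨⟨‖y‖⁻¹ • y, by simp [norm_smul, hy0.ne']⟩, ?_, ‖y‖, ⟨by linarith, by linarith⟩,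
      by simp [smul_smul, hy0.ne']⟩
    rw [mem_closedBall, Subtype.dist_eq, dist_eq_norm]
    have e3 : ‖y‖ • (‖y‖⁻¹ • y - ω₀.1) =
        (y - (1 - d / 2) • ω₀.1) + (1 - d / 2 - ‖y‖) • ω₀.1 := by
      rw [smul_sub, smul_smul, mul_inv_cancel₀ hy0.ne']; module
    have e4 : ‖y‖ * ‖‖y‖⁻¹ • y - ω₀.1‖ ≤ 1 / 8 * d + 1 / 8 * d := by
      calc ‖y‖ * ‖‖y‖⁻¹ • y - ω₀.1‖ = ‖‖y‖ • (‖y‖⁻¹ • y - ω₀.1)‖ := by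
            rw [norm_smul, norm_norm]
        _ ≤ _ := by
            rw [e3]
            refine (norm_add_le _ _).trans (add_le_add hy ?_)
            rw [norm_smul, hω₀, mul_one, Real.norm_eq_abs, abs_le]
            constructor <;> linarith
    have e5 : (1 / 2) * ‖‖y‖⁻¹ • y - ω₀.1‖ ≤ ‖y‖ * ‖‖y‖⁻¹ • y - ω₀.1‖ := by
      gcongr; linarith
    change ‖‖y‖⁻¹ • y - ω₀.1‖ ≤ d
    linarith
  have h1 := measure_mono (μ := μ) hsub
  rw [Measure.addHaar_closedBall' μ _ (by positivity), ← setLIntegral_one (sector _ _ _),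
    setLIntegral_sector μ measurableSet_closedBall (by linarith) measurable_const] at h1
  have h2 : ENNReal.ofReal ((1 / 8 * d) ^ Module.finrank ℝ E) * μ (closedBall 0 1) ≤
      ENNReal.ofReal d * μ.toSphere (closedBall ω₀ d) := by
    refine h1.trans ?_
    rw [← setLIntegral_const]
    refine lintegral_mono fun ω => ?_
    calc _ ≤ ∫⁻ r in Ioo (1 - d) 1, 1 := by
          refine setLIntegral_mono' measurableSet_Ioo fun r hr => ?_
          rw [mul_one, ENNReal.ofReal_le_one]
          exact pow_le_one₀ (by linarith [hr.1]) hr.2.le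
      _ = ENNReal.ofReal d := by simp
  have h3 : ENNReal.ofReal ((1 / 8 * d) ^ Module.finrank ℝ E) * μ (closedBall 0 1) =
      ENNReal.ofReal d * (ENNReal.ofReal ((1 / 8) ^ Module.finrank ℝ E) * μ (closedBall 0 1) *
        ENNReal.ofReal (d ^ (Module.finrank ℝ E - 1))) := by
    have : (1 / 8 * d) ^ Module.finrank ℝ E =
        d * ((1 / 8) ^ Module.finrank ℝ E * d ^ (Module.finrank ℝ E - 1)) := by
      rw [mul_pow, ← mul_pow_sub_one hN.ne' d]; ring
    rw [this, ENNReal.ofReal_mul hd.le, ENNReal.ofReal_mul (by positivity)]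
    ring
  rw [h3] at h2
  exact (ENNReal.mul_le_mul_iff_right (by simpa using hd) ENNReal.ofReal_ne_top).1 h2

theorem toSphere_le_hausdorffMeasure (A : Set (sphere (0 : E) 1)) :
    μ.toSphere A ≤ ENNReal.ofReal (2 ^ Module.finrank ℝ E) * μ (closedBall 0 1) *
      μH[((Module.finrank ℝ E - 1 : ℕ) : ℝ)] A := by
  set C := ENNReal.ofReal (2 ^ Module.finrank ℝ E) * μ (closedBall 0 1) with hC
  have hC0 : C ≠ 0 := mul_ne_zero (by positivity) (measure_closedBall_pos μ 0 one_pos).ne'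
  have hCt : C ≠ ⊤ := ENNReal.mul_ne_top ENNReal.ofReal_ne_top measure_closedBall_lt_top.ne
  have key : C⁻¹ • μ.toSphere ≤ μH[((Module.finrank ℝ E - 1 : ℕ) : ℝ)] := by
    refine Measure.le_hausdorffMeasure _ _ 1 one_pos fun s hs => ?_
    rcases s.eq_empty_or_nonempty with rfl | ⟨ω₀, hω₀⟩
    · simp
    have hfin : ediam s ≠ ⊤ := ne_top_of_le_ne_top ENNReal.one_ne_top hs
    have h1 : ∀ d > (ediam s).toReal,
        μ.toSphere s ≤ C * ENNReal.ofReal (d ^ (Module.finrank ℝ E - 1)) := by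
      intro d hd
      refine (measure_mono fun ω hω => ?_).trans
        (toSphere_closedBall_le μ ω₀ (ENNReal.toReal_nonneg.trans_lt hd))
      rw [mem_closedBall]
      exact (dist_le_diam_of_mem' hfin hω hω₀).trans hd.le
    have h2 : μ.toSphere s ≤
        C * ENNReal.ofReal ((ediam s).toReal ^ (Module.finrank ℝ E - 1)) := by
      have hc : Continuous fun d : ℝ => C * ENNReal.ofReal (d ^ (Module.finrank ℝ E - 1)) :=
        (ENNReal.continuous_const_mul hCt).comp
          (ENNReal.continuous_ofReal.comp (continuous_pow _))
      exact ge_of_tendsto (hc.continuousWithinAt (s := Ioi (ediam s).toReal))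
        (eventually_mem_nhdsWithin.mono h1)
    rw [Measure.smul_apply, smul_eq_mul, ENNReal.rpow_natCast]
    rw [ENNReal.ofReal_pow ENNReal.toReal_nonneg, ENNReal.ofReal_toReal hfin] at h2
    exact (ENNReal.inv_mul_le_iff hC0 hCt).2 h2
  have := key A
  rw [Measure.smul_apply, smul_eq_mul] at this
  exact (ENNReal.inv_mul_le_iff hC0 hCt).1 this

end SphereCaps

theorem toSphere_le_sphMeasure {n : ℕ} (hn : 2 ≤ n) :
    ∃ C : ℝ≥0∞, C ≠ ⊤ ∧ ∀ A : Set (sphere (0 : Vec n) 1),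
      (volume : Measure (Vec n)).toSphere A ≤ C * sphMeasure n ((↑) '' A) := by
  have : Nontrivial (Fin n) := Fin.nontrivial_iff_two_le.2 hn
  refine ⟨ENNReal.ofReal (2 ^ Module.finrank ℝ (Vec n)) *
      (volume : Measure (Vec n)) (closedBall 0 1), ENNReal.mul_ne_top ENNReal.ofReal_ne_top
    (measure_closedBall_lt_top (μ := (volume : Measure (Vec n))) (x := 0) (r := 1)).ne,
    fun A => (toSphere_le_hausdorffMeasure volume A).trans ?_⟩
  have h1 : (((Module.finrank ℝ (Vec n) - 1 : ℕ)) : ℝ) = (n : ℝ) - 1 := by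
    rw [finrank_euclideanSpace_fin, Nat.cast_sub (by omega)]; simp
  have h2 : (0 : ℝ) ≤ (n : ℝ) - 1 := by rw [← h1]; positivity
  rw [h1, ← (isometry_subtype_coe (s := sphere (0 : Vec n) 1)).hausdorffMeasure_image (.inl h2),
    sphMeasure, Measure.restrict_eq_self]
  rintro _ ⟨ω, -, rfl⟩
  exact ω.2

theorem sphMeasure_unitSphere_lt_top {n : ℕ} (hn : 2 ≤ n) : sphMeasure n (unitSphere n) < ⊤ := by
  obtain ⟨m, rfl⟩ : ∃ m, n = m + 1 := ⟨n - 1, by omega⟩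
  let Φ : Fin (m + 1) → ℝ → (Fin m → ℝ) → Vec (m + 1) := fun i s u =>
    WithLp.toLp 2 (i.insertNth s u)
  have hΦ0 : ∀ i s u, s ≠ 0 → Φ i s u ≠ 0 := by
    intro i s u hs h
    have := congrArg (fun v : Vec (m + 1) => v i) h
    simp [Φ] at this
    exact hs this
  have hΦd : ∀ i s, ContDiff ℝ 1 (Φ i s) := by
    intro i s
    rw [contDiff_euclidean]
    intro j
    refine Fin.succAboveCases i ?_ (fun k => ?_) j
    · simpa [Φ] using contDiff_const
    · simpa [Φ] using contDiff_apply ℝ ℝ k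
  let Ψ : Fin (m + 1) → ℝ → (Fin m → ℝ) → Vec (m + 1) := fun i s u => ‖Φ i s u‖⁻¹ • Φ i s u
  have hΨ : ∀ i s, s ≠ 0 → ContDiff ℝ 1 (Ψ i s) := by
    intro i s hs
    refine ContDiff.smul (ContDiff.inv ((hΦd i s).norm ℝ fun u => hΦ0 i s u hs)
      fun u => norm_ne_zero_iff.2 (hΦ0 i s u hs)) (hΦd i s)
  have hfin : ∀ i s, s ≠ 0 → μH[(m : ℝ)] (Ψ i s '' Icc (-1) 1) < ⊤ := by
    intro i s hs
    obtain ⟨K, hK⟩ := (hΨ i s hs).contDiffOn.exists_lipschitzOnWith (s := Icc (-1) 1) one_ne_zero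
      (convex_Icc _ _) isCompact_Icc
    refine (hK.hausdorffMeasure_image_le (by positivity)).trans_lt ?_
    have hv : (μH[(m : ℝ)] : Measure (Fin m → ℝ)) = volume := by
      simpa using hausdorffMeasure_pi_real (ι := Fin m)
    rw [hv]
    exact ENNReal.mul_lt_top (ENNReal.rpow_lt_top_of_nonneg (by positivity) ENNReal.coe_ne_top)
      isCompact_Icc.measure_lt_top
  have hcov : unitSphere (m + 1) ⊆
      ⋃ i, (Ψ i 1 '' Icc (-1) 1 ∪ Ψ i (-1) '' Icc (-1) 1) := by
    intro x hx
    have hx1 : ‖x‖ = 1 := by simpa [unitSphere] using hx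
    obtain ⟨i, hi⟩ := Finite.exists_max fun j => |x j|
    have hxi : 0 < |x i| := by
      by_contra! h
      have : x = 0 := by
        ext j
        simpa using (hi j).trans h
      simp [this] at hx1
    have hxi0 : x i ≠ 0 := abs_pos.1 hxi
    have hu : (fun j => |x i|⁻¹ * x (i.succAbove j)) ∈ Icc (-1 : Fin m → ℝ) 1 := by
      have : ∀ j, |(|x i|⁻¹ * x (i.succAbove j))| ≤ 1 := by
        intro j
        rw [abs_mul, abs_inv, abs_abs, inv_mul_le_iff₀ hxi, mul_one]
        exact hi _
      exact ⟨fun j => (abs_le.1 (this j)).1, fun j => (abs_le.1 (this j)).2⟩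
    have key : ∀ s : ℝ, |x i| * s = x i →
        Ψ i s (fun j => |x i|⁻¹ * x (i.succAbove j)) = x := by
      intro s hs
      have e : Φ i s (fun j => |x i|⁻¹ * x (i.succAbove j)) = |x i|⁻¹ • x := by
        ext j
        refine Fin.succAboveCases i ?_ (fun k => ?_) j
        · simp only [Φ, Fin.insertNth_apply_same, PiLp.smul_apply, smul_eq_mul]
          rw [eq_inv_mul_iff_mul_eq₀ hxi.ne', hs]
        · simp [Φ]
      simp only [Ψ, e, norm_smul, hx1, norm_inv, Real.norm_eq_abs, abs_abs, mul_one, inv_inv,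
        smul_smul, mul_inv_cancel₀ hxi.ne', one_smul]
    refine mem_iUnion.2 ⟨i, ?_⟩
    rcases abs_choice (x i) with h | h
    · exact .inl ⟨_, hu, key 1 (by linarith)⟩
    · exact .inr ⟨_, hu, key (-1) (by linarith)⟩
  rw [sphMeasure, Measure.restrict_apply_self]
  refine (measure_mono hcov).trans_lt ?_
  have hm : ((m + 1 : ℕ) : ℝ) - 1 = m := by push_cast; ring
  rw [hm]
  refine (measure_iUnion_le _).trans_lt ?_
  rw [tsum_fintype]
  refine ENNReal.sum_lt_top.2 fun i _ => (measure_union_le _ _).trans_lt ?_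
  exact ENNReal.add_lt_top.2 ⟨hfin i 1 one_ne_zero, hfin i (-1) (by norm_num)⟩

theorem mobiusT_eq {n : ℕ} (x y : Vec n) :
    mobiusT n x y = (‖x‖ ^ 2 * ‖y‖ ^ 2 - 2 * inner ℝ x y + 1)⁻¹ •
      ((1 - ‖x‖ ^ 2) • y - (1 + ‖y‖ ^ 2 - 2 * inner ℝ x y) • x) := by
  by_cases hx : x = 0
  · simp [mobiusT, hx]
  · have hs : ‖x‖ ^ 2 ≠ 0 := by simpa using hx
    rw [mobiusT, if_neg hx, norm_sub_sq_real, norm_sub_sq_real, norm_smul, inner_smul_right,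
      real_inner_comm x y]
    congr 1
    · rw [mul_pow, norm_inv, Real.norm_of_nonneg (sq_nonneg ‖x‖)]
      field_simp
    · module

theorem mobiusT_neg_zero {n : ℕ} (x : Vec n) : mobiusT n (-x) 0 = x := by
  simp [mobiusT_eq]

theorem norm_sub_sq_add_eq {n : ℕ} (x y : Vec n) :
    ‖x - y‖ ^ 2 + (1 - ‖x‖ ^ 2) * (1 - ‖y‖ ^ 2) =
      ‖x‖ ^ 2 * ‖y‖ ^ 2 - 2 * inner ℝ x y + 1 := by
  rw [norm_sub_sq_real]; ring

theorem one_sub_norm_sq_pos {n : ℕ} {x : Vec n} (hx : x ∈ unitBall n) : 0 < 1 - ‖x‖ ^ 2 := by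
  have : ‖x‖ < 1 := by simpa [unitBall] using hx
  nlinarith [norm_nonneg x]

theorem mobius_denom_pos {n : ℕ} {x y : Vec n} (hx : x ∈ unitBall n) (hy : y ∈ unitBall n) :
    0 < ‖x‖ ^ 2 * ‖y‖ ^ 2 - 2 * inner ℝ x y + 1 := by
  rw [← norm_sub_sq_add_eq]
  have := mul_pos (one_sub_norm_sq_pos hx) (one_sub_norm_sq_pos hy)
  positivity

theorem norm_mobiusT_sq {n : ℕ} {x y : Vec n} (hx : x ∈ unitBall n) (hy : y ∈ unitBall n) :
    ‖mobiusT n x y‖ ^ 2 =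
      1 - (1 - ‖x‖ ^ 2) * (1 - ‖y‖ ^ 2) / (‖x‖ ^ 2 * ‖y‖ ^ 2 - 2 * inner ℝ x y + 1) := by
  have hA := mobius_denom_pos hx hy
  rw [mobiusT_eq, norm_smul, mul_pow, norm_sub_sq_real, norm_smul, norm_smul, inner_smul_left,
    inner_smul_right, real_inner_comm x y, mul_pow, mul_pow]
  simp only [Real.norm_eq_abs, sq_abs, conj_trivial]
  generalize inner ℝ x y = t at *
  generalize ‖x‖ ^ 2 = s at *
  generalize ‖y‖ ^ 2 = q at *
  field_simp
  ring

theorem mobiusT_neg_mobiusT {n : ℕ} {x y : Vec n} (hx : x ∈ unitBall n) (hy : y ∈ unitBall n) :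
    mobiusT n (-x) (mobiusT n x y) = y := by
  have hA := mobius_denom_pos hx hy
  have hs := one_sub_norm_sq_pos hx
  have hu : inner ℝ x (mobiusT n x y) = ((1 - ‖x‖ ^ 2) * inner ℝ x y -
      (1 + ‖y‖ ^ 2 - 2 * inner ℝ x y) * ‖x‖ ^ 2) /
        (‖x‖ ^ 2 * ‖y‖ ^ 2 - 2 * inner ℝ x y + 1) := by
    rw [mobiusT_eq, inner_smul_right, inner_sub_right, inner_smul_right, inner_smul_right,
      real_inner_self_eq_norm_sq]
    field_simp
  rw [mobiusT_eq (-x), norm_neg, inner_neg_left, norm_mobiusT_sq hx hy, hu, mobiusT_eq x y]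
  generalize inner ℝ x y = t at *
  generalize ‖x‖ ^ 2 = s at *
  generalize ‖y‖ ^ 2 = q at *
  have e1 : s * (1 - (1 - s) * (1 - q) / (s * q - 2 * t + 1)) -
      2 * -(((1 - s) * t - (1 + q - 2 * t) * s) / (s * q - 2 * t + 1)) + 1 =
        (1 - s) ^ 2 / (s * q - 2 * t + 1) := by
    field_simp; ring
  have e2 : 1 + (1 - (1 - s) * (1 - q) / (s * q - 2 * t + 1)) -
      2 * -(((1 - s) * t - (1 + q - 2 * t) * s) / (s * q - 2 * t + 1)) =
        (1 - s) * (1 + q - 2 * t) / (s * q - 2 * t + 1) := by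
    field_simp; ring
  rw [e1, e2]
  match_scalars
  · field_simp
  · field_simp
    ring

theorem mobiusT_mem_unitBall {n : ℕ} {x y : Vec n} (hx : x ∈ unitBall n) (hy : y ∈ unitBall n) :
    mobiusT n x y ∈ unitBall n := by
  have h1 := norm_mobiusT_sq hx hy
  have h2 := div_pos (mul_pos (one_sub_norm_sq_pos hx) (one_sub_norm_sq_pos hy))
    (mobius_denom_pos hx hy)
  have : ‖mobiusT n x y‖ < 1 := by nlinarith [norm_nonneg (mobiusT n x y)]
  simpa [unitBall] using this

theorem le_one_sub_norm_mobiusT {n : ℕ} {x y : Vec n} (hx : x ∈ unitBall n) (hxy : ‖x‖ ≤ ‖y‖)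
    (hy : y ∈ unitBall n) (h : ‖x - y‖ ≤ 2 * (1 - ‖x‖)) :
    (1 - ‖y‖) / (16 * (1 - ‖x‖)) ≤ 1 - ‖mobiusT n x y‖ := by
  have hx1 : ‖x‖ < 1 := by simpa [unitBall] using hx
  have hy1 : ‖y‖ < 1 := by simpa [unitBall] using hy
  have hz : ‖mobiusT n x y‖ < 1 := by simpa [unitBall] using mobiusT_mem_unitBall hx hy
  have hA := mobius_denom_pos hx hy
  have h1 := norm_mobiusT_sq hx hy
  have hx0 := norm_nonneg x
  have hy0 := norm_nonneg y
  have hA8 : ‖x‖ ^ 2 * ‖y‖ ^ 2 - 2 * inner ℝ x y + 1 ≤ 8 * (1 - ‖x‖) ^ 2 := by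
    rw [← norm_sub_sq_add_eq]
    have e1 : ‖x - y‖ ^ 2 ≤ (2 * (1 - ‖x‖)) ^ 2 := by gcongr
    have e2 : 1 - ‖x‖ ^ 2 ≤ 2 * (1 - ‖x‖) := by nlinarith
    have e3 : 1 - ‖y‖ ^ 2 ≤ 2 * (1 - ‖x‖) := by nlinarith
    have e4 := mul_le_mul e2 e3 (one_sub_norm_sq_pos hy).le (by linarith)
    nlinarith
  have h2 : (1 - ‖y‖) / (8 * (1 - ‖x‖)) ≤ 1 - ‖mobiusT n x y‖ ^ 2 := by
    rw [h1, sub_sub_cancel]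
    have e2 : 1 - ‖x‖ ≤ 1 - ‖x‖ ^ 2 := by nlinarith
    have e3 : 1 - ‖y‖ ≤ 1 - ‖y‖ ^ 2 := by nlinarith
    calc (1 - ‖y‖) / (8 * (1 - ‖x‖)) = ((1 - ‖x‖) * (1 - ‖y‖)) / (8 * (1 - ‖x‖) ^ 2) := by
          have : 1 - ‖x‖ ≠ 0 := by linarith
          field_simp
      _ ≤ _ := by
          gcongr
          · exact mul_nonneg (one_sub_norm_sq_pos hx).le (one_sub_norm_sq_pos hy).le
          · linarith
  have h3 : (1 - ‖y‖) / (16 * (1 - ‖x‖)) = (1 - ‖y‖) / (8 * (1 - ‖x‖)) / 2 := by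
    rw [div_div]; congr 1; ring
  rw [h3]
  nlinarith [norm_nonneg (mobiusT n x y)]

theorem InMiniowitz.le_norm {n : ℕ} {C₀ α : ℝ} {f : Vec n → Vec n} (hC₀ : 1 ≤ C₀) (hα : 0 < α)
    (hf0 : ∀ x ∈ unitBall n, f x ≠ 0) (hMin : InMiniowitz n C₀ α f) {x y : Vec n}
    (hx : x ∈ unitBall n) (hxy : ‖x‖ = ‖y‖) (h : ‖x - y‖ ≤ 2 * (1 - ‖x‖)) :
    C₀⁻¹ * (1 / 32) ^ α * ‖f x‖ ≤ ‖f y‖ := by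
  have hx1 : ‖x‖ < 1 := by simpa [unitBall] using hx
  have hy : y ∈ unitBall n := by simpa [unitBall, ← hxy] using hx1
  have hz := mobiusT_mem_unitBall hx hy
  have hz1 : ‖mobiusT n x y‖ < 1 := by simpa [unitBall] using hz
  have h1 := (hMin x hx _ hz).1
  rw [mobiusT_neg_mobiusT hx hy, mobiusT_neg_zero, le_div_iff₀ (norm_pos_iff.2 (hf0 x hx))] at h1
  refine le_trans ?_ h1
  have h2 := le_one_sub_norm_mobiusT hx hxy.le hy h
  have h3 : (1 - ‖y‖) / (16 * (1 - ‖x‖)) = 1 / 16 := by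
    rw [← hxy]
    have : 1 - ‖x‖ ≠ 0 := by linarith
    field_simp
  rw [h3] at h2
  have : (1 : ℝ) / 32 ≤ (1 - ‖mobiusT n x y‖) / (1 + ‖mobiusT n x y‖) := by
    rw [div_le_div_iff₀ (by norm_num) (by positivity)]
    nlinarith
  gcongr

theorem MultCond.encard_le {n : ℕ} {a C₁ : ℝ} {f : Vec n → Vec n} (hM : MultCond n a C₁ f)
    {x : Vec n} (hx : x ∈ unitBall n) {A : Set (Vec n)} (hA : A ⊆ unitBall n) {ε : ℝ}
    (hε : 0 < ε) (hε1 : ε < 1) (h : ∀ y ∈ A, ε < 1 - ‖mobiusT n x y‖) (w : Vec n) :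
    (({y ∈ A | f y = w}.encard : ℕ∞) : ℝ≥0∞) ≤ ENNReal.ofReal (C₁ / ε ^ a) := by
  have h1 := hM x hx (1 - ε) (by linarith) (by linarith) w
  rw [sub_sub_cancel] at h1
  refine le_trans ?_ h1
  rw [ENat.toENNReal_le]
  refine encard_le_encard_of_injOn (f := mobiusT n x) ?_ ?_
  · rintro y ⟨hy, rfl⟩
    refine ⟨?_, by rw [mobiusT_neg_mobiusT hx (hA hy)]⟩
    rw [mem_ball_zero_iff]
    linarith [h y hy]
  · intro y hy y' hy' e
    rw [← mobiusT_neg_mobiusT hx (hA hy.1), e, mobiusT_neg_mobiusT hx (hA hy'.1)]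

/-- The area inequality for a differentiable map of bounded multiplicity. -/
theorem setLIntegral_abs_det_mul_comp_le {E : Type*} [NormedAddCommGroup E] [NormedSpace ℝ E]
    [MeasurableSpace E] [BorelSpace E] [FiniteDimensional ℝ E]
    (μ : Measure E) [μ.IsAddHaarMeasure] {f : E → E} {A : Set E} (hA : MeasurableSet A)
    (hf : ∀ y ∈ A, DifferentiableAt ℝ f y) {N : ℝ≥0∞}
    (hN : ∀ w, (({y ∈ A | f y = w}.encard : ℕ∞) : ℝ≥0∞) ≤ N) {φ : E → ℝ≥0∞}
    (hφ : Measurable φ) :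
    ∫⁻ y in A, ENNReal.ofReal |(fderiv ℝ f y).det| * φ (f y) ∂μ ≤ N * ∫⁻ w, φ w ∂μ := by
  set S := A ∩ {y | (fderiv ℝ f y).det ≠ 0} with hS
  have hdet : Measurable fun y => (fderiv ℝ f y).det :=
    ContinuousLinearMap.continuous_det.measurable.comp (measurable_fderiv ℝ f)
  have hSm : MeasurableSet S := hA.inter (hdet (measurableSet_singleton 0).compl)
  have hinv : ∀ L : E →L[ℝ] E, ∃ c : ℝ≥0, c ≠ 0 ∧
      (L.det ≠ 0 → ∀ s : Set E, ApproximatesLinearOn f L s c → InjOn f s) := by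
    intro L
    by_cases hL : L.det = 0
    · exact ⟨1, one_ne_zero, fun h => absurd hL h⟩
    set e := L.toContinuousLinearEquivOfDetNeZero hL with he
    have hcoe : (e : E →L[ℝ] E) = L := L.coe_toContinuousLinearEquivOfDetNeZero hL
    rcases subsingleton_or_nontrivial E with hE | hE
    · exact ⟨1, one_ne_zero, fun _ s _ x _ y _ _ => Subsingleton.elim _ _⟩
    have hpos : 0 < ‖(e.symm : E →L[ℝ] E)‖₊⁻¹ := inv_pos.2 e.nnnorm_symm_pos
    refine ⟨‖(e.symm : E →L[ℝ] E)‖₊⁻¹ / 2, (half_pos hpos).ne', fun _ s hs => ?_⟩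
    rw [← hcoe] at hs
    exact hs.injOn (.inr (NNReal.half_lt_self hpos.ne'))
  choose r hr0 hr using hinv
  obtain ⟨t, L, htd, htm, hSt, happ, hL⟩ :=
    exists_partition_approximatesLinearOn_of_hasFDerivWithinAt f S (fderiv ℝ f)
      (fun y hy => (hf y hy.1).hasFDerivAt.hasFDerivWithinAt) r hr0
  have hinj : ∀ k, InjOn f (S ∩ t k) := by
    intro k
    rcases S.eq_empty_or_nonempty with h | h
    · simp [h]
    obtain ⟨y, hy, hLy⟩ := hL h k
    exact hr (L k) (by rw [hLy]; exact hy.2) _ (happ k)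
  have hm : ∀ k, MeasurableSet (S ∩ t k) := fun k => hSm.inter (htm k)
  have himg : ∀ k, MeasurableSet (f '' (S ∩ t k)) := fun k =>
    measurable_image_of_fderivWithin (hm k)
      (fun y hy => (hf y hy.1.1).hasFDerivAt.hasFDerivWithinAt) (hinj k)
  have hcount : ∀ w, ∑' k, (f '' (S ∩ t k)).indicator (fun _ => (1 : ℝ≥0∞)) w ≤ N := by
    intro w
    rw [ENNReal.tsum_eq_iSup_sum]
    refine iSup_le fun F => le_trans ?_ (hN w)
    have e1 : ∑ k ∈ F, (f '' (S ∩ t k)).indicator (fun _ => (1 : ℝ≥0∞)) w =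
        ((F.filter fun k => w ∈ f '' (S ∩ t k)).card : ℝ≥0∞) := by
      rw [Finset.card_filter]
      push_cast
      exact Finset.sum_congr rfl fun k _ => by simp [indicator]
    rw [e1, ← ENat.toENNReal_coe, ENat.toENNReal_le, ← encard_coe_eq_coe_finsetCard]
    have hch : ∀ k : ℕ, ∃ y, w ∈ f '' (S ∩ t k) → y ∈ S ∩ t k ∧ f y = w := by
      intro k
      by_cases h : w ∈ f '' (S ∩ t k)
      · obtain ⟨y, hy⟩ := h
        exact ⟨y, fun _ => hy⟩
      · exact ⟨0, fun h' => absurd h' h⟩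
    choose g hg using hch
    refine encard_le_encard_of_injOn (f := g) ?_ ?_
    · intro k hk
      have := hg k (Finset.mem_filter.1 hk).2
      exact ⟨this.1.1.1, this.2⟩
    · intro k hk l hl e
      by_contra hkl
      have h1 := (hg k (Finset.mem_filter.1 hk).2).1.2
      have h2 := (hg l (Finset.mem_filter.1 hl).2).1.2
      rw [e] at h1
      exact disjoint_left.1 (htd hkl) h1 h2
  calc ∫⁻ y in A, ENNReal.ofReal |(fderiv ℝ f y).det| * φ (f y) ∂μ
      = ∫⁻ y in S, ENNReal.ofReal |(fderiv ℝ f y).det| * φ (f y) ∂μ := by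
        rw [← lintegral_indicator hA, ← lintegral_indicator hSm]
        refine lintegral_congr fun y => ?_
        by_cases hy : y ∈ A
        · by_cases hd : (fderiv ℝ f y).det = 0
          · simp [indicator, hd]
          · rw [indicator_of_mem hy, indicator_of_mem (show y ∈ S from ⟨hy, hd⟩)]
        · rw [indicator_of_notMem hy, indicator_of_notMem fun h => hy h.1]
    _ = ∫⁻ y in ⋃ k, S ∩ t k, ENNReal.ofReal |(fderiv ℝ f y).det| * φ (f y) ∂μ := by
        rw [← inter_iUnion, inter_eq_left.2 hSt]
    _ = ∑' k, ∫⁻ y in S ∩ t k, ENNReal.ofReal |(fderiv ℝ f y).det| * φ (f y) ∂μ :=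
        lintegral_iUnion hm (fun k l hkl =>
          (htd hkl).mono inter_subset_right inter_subset_right) _
    _ = ∑' k, ∫⁻ w, (f '' (S ∩ t k)).indicator (fun _ => (1 : ℝ≥0∞)) w * φ w ∂μ := by
        congr 1; ext k
        rw [← lintegral_image_eq_lintegral_abs_det_fderiv_mul μ (hm k)
          (fun y hy => (hf y hy.1.1).hasFDerivAt.hasFDerivWithinAt) (hinj k),
          ← lintegral_indicator (himg k)]
        refine lintegral_congr fun w => ?_
        by_cases h : w ∈ f '' (S ∩ t k) <;> simp [indicator, h]
    _ = ∫⁻ w, (∑' k, (f '' (S ∩ t k)).indicator (fun _ => (1 : ℝ≥0∞)) w) * φ w ∂μ := by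
        simp_rw [← ENNReal.tsum_mul_right]
        rw [lintegral_tsum]
        exact fun k => ((measurable_const.indicator (himg k)).mul hφ).aemeasurable
    _ ≤ ∫⁻ w, N * φ w ∂μ := lintegral_mono fun w => by gcongr; exact hcount w
    _ = N * ∫⁻ w, φ w ∂μ := lintegral_const_mul _ hφ

/-- The set of points of the unit ball where `|f|` lies between `m * exp (-Λ)` and `m`. -/
def levelShell {n : ℕ} (f : Vec n → Vec n) (m Λ : ℝ) : Set (Vec n) :=
  {y ∈ unitBall n | m * Real.exp (-Λ) < ‖f y‖ ∧ ‖f y‖ < m}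

/-- The logarithmic gradient `‖Df‖ / |f|` cut off outside `levelShell f m Λ`. -/
def logGrad {n : ℕ} (f : Vec n → Vec n) (m Λ : ℝ) : Vec n → ℝ≥0∞ :=
  (levelShell f m Λ).indicator fun y => ENNReal.ofReal (‖fderiv ℝ f y‖ / ‖f y‖)

theorem isOpen_levelShell {n : ℕ} {f : Vec n → Vec n} (hf : ContinuousOn f (unitBall n))
    (m Λ : ℝ) : IsOpen (levelShell f m Λ) :=
  hf.norm.isOpen_inter_preimage isOpen_ball (isOpen_Ioo (a := m * Real.exp (-Λ)) (b := m))

theorem measurable_logGrad {n : ℕ} {f : Vec n → Vec n} (hf : ContinuousOn f (unitBall n))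
    (m Λ : ℝ) : Measurable (logGrad f m Λ) := by
  have h0 : Measurable ((unitBall n).piecewise f 0) :=
    hf.measurable_piecewise continuousOn_const measurableSet_ball
  have : logGrad f m Λ = (levelShell f m Λ).indicator fun y =>
      ENNReal.ofReal (‖fderiv ℝ f y‖ / ‖(unitBall n).piecewise f 0 y‖) := by
    refine indicator_congr fun y hy => ?_
    rw [piecewise_eq_of_mem _ _ _ hy.1]
  rw [this]
  refine Measurable.indicator ?_ (isOpen_levelShell hf m Λ).measurableSet
  exact ((measurable_fderiv ℝ f).norm.div h0.norm).ennreal_ofReal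

theorem lintegral_shell_inv_norm_pow_le {n : ℕ} (hn : 2 ≤ n) {m Λ : ℝ} (hm : 0 < m)
    (hΛ : 0 < Λ) :
    ∫⁻ w : Vec n, {w : Vec n | m * Real.exp (-Λ) < ‖w‖ ∧ ‖w‖ < m}.indicator
        (fun w => ENNReal.ofReal ((‖w‖ ^ n)⁻¹)) w ≤
      ENNReal.ofReal Λ * (volume : Measure (Vec n)).toSphere univ := by
  have : Nontrivial (Fin n) := Fin.nontrivial_iff_two_le.2 hn
  have hms : MeasurableSet {w : Vec n | m * Real.exp (-Λ) < ‖w‖ ∧ ‖w‖ < m} :=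
    measurable_norm (measurableSet_Ioo (a := m * Real.exp (-Λ)) (b := m))
  have he : 0 < m * Real.exp (-Λ) := by positivity
  have hem : m * Real.exp (-Λ) ≤ m := by
    have : Real.exp (-Λ) ≤ 1 := Real.exp_le_one_iff.2 (by linarith)
    nlinarith
  rw [lintegral_eq_lintegral_toSphere volume
    (Measurable.indicator (by fun_prop) hms), ← lintegral_const]
  refine lintegral_mono fun ω => ?_
  have hω : ‖ω.1‖ = 1 := by simp
  rw [finrank_euclideanSpace_fin]
  calc _ ≤ ∫⁻ r, (Ioo (m * Real.exp (-Λ)) m).indicator (fun r => ENNReal.ofReal r⁻¹) r := by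
        rw [← lintegral_indicator measurableSet_Ioi]
        refine lintegral_mono fun r => ?_
        by_cases hr : 0 < r
        · rw [indicator_of_mem (show r ∈ Ioi 0 from hr)]
          have hn' : ‖r • ω.1‖ = r := by rw [norm_smul, hω, mul_one, Real.norm_of_nonneg hr.le]
          by_cases hr' : r ∈ Ioo (m * Real.exp (-Λ)) m
          · rw [indicator_of_mem hr', indicator_of_mem (by simpa [hn'] using hr'), hn',
              ← ENNReal.ofReal_mul (by positivity)]
            refine ENNReal.ofReal_le_ofReal (le_of_eq ?_)
            rw [← pow_sub_one_mul (by omega : n ≠ 0) r]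
            field_simp
          · rw [indicator_of_notMem (s := {w : Vec n | _}) (by simpa [hn'] using hr'), mul_zero]
            exact zero_le
        · rw [indicator_of_notMem (show r ∉ Ioi 0 from hr)]
          exact zero_le
    _ = ∫⁻ r in Ioc (m * Real.exp (-Λ)) m, ENNReal.ofReal r⁻¹ := by
        rw [lintegral_indicator measurableSet_Ioo, restrict_Ioo_eq_restrict_Ioc]
    _ = ENNReal.ofReal (∫ r in (m * Real.exp (-Λ))..m, r⁻¹) := by
        rw [intervalIntegral.integral_of_le hem, ofReal_integral_eq_lintegral_ofReal]
        · have : IntervalIntegrable (fun r : ℝ => r⁻¹) volume (m * Real.exp (-Λ)) m := by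
            refine intervalIntegral.intervalIntegrable_inv (fun r hr => ?_) continuousOn_id
            rw [uIcc_of_le hem] at hr
            exact (he.trans_le hr.1).ne'
          exact this.1
        · refine (ae_restrict_iff' measurableSet_Ioc).2 (.of_forall fun r hr => ?_)
          exact inv_nonneg.2 (he.trans hr.1).le
    _ = ENNReal.ofReal Λ := by
        rw [integral_inv_of_pos he hm]
        congr 1
        rw [div_mul_cancel_left₀ hm.ne', ← Real.exp_neg, neg_neg, Real.log_exp]

theorem setLIntegral_logGrad_pow_le {n : ℕ} (hn : 2 ≤ n) {K : ℝ} (hK : 1 ≤ K)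
    {f : Vec n → Vec n} (hf : IsQR n K f) {m Λ : ℝ} (hm : 0 < m) (hΛ : 0 < Λ)
    {A : Set (Vec n)} (hA : MeasurableSet A) (hAB : A ⊆ unitBall n) {N : ℝ≥0∞}
    (hN : ∀ w, (({y ∈ A | f y = w}.encard : ℕ∞) : ℝ≥0∞) ≤ N) :
    ∫⁻ y in A, logGrad f m Λ y ^ n ≤
      ENNReal.ofReal K * (N * (ENNReal.ofReal Λ * (volume : Measure (Vec n)).toSphere univ)) := by
  set φ : Vec n → ℝ≥0∞ := {w : Vec n | m * Real.exp (-Λ) < ‖w‖ ∧ ‖w‖ < m}.indicator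
    (fun w => ENNReal.ofReal ((‖w‖ ^ n)⁻¹)) with hφ
  have hφm : Measurable φ := Measurable.indicator (by fun_prop)
    (measurable_norm (measurableSet_Ioo (a := m * Real.exp (-Λ)) (b := m)))
  have h1 : ∀ᵐ y ∂(volume.restrict A), logGrad f m Λ y ^ n ≤
      ENNReal.ofReal K * (ENNReal.ofReal |(fderiv ℝ f y).det| * φ (f y)) := by
    filter_upwards [ae_mono (Measure.restrict_mono hAB le_rfl) hf.2.2] with y hy
    by_cases hU : y ∈ levelShell f m Λ
    · have : f y ∈ {w : Vec n | m * Real.exp (-Λ) < ‖w‖ ∧ ‖w‖ < m} := hU.2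
      rw [logGrad, indicator_of_mem hU, hφ, indicator_of_mem this,
        ← ENNReal.ofReal_pow (by positivity), ← ENNReal.ofReal_mul (by positivity),
        ← ENNReal.ofReal_mul (by positivity)]
      refine ENNReal.ofReal_le_ofReal ?_
      rw [div_pow, div_eq_mul_inv, ← mul_assoc]
      gcongr
      exact hy.trans (by gcongr; exact le_abs_self _)
    · rw [logGrad, indicator_of_notMem hU, zero_pow (by omega)]
      exact zero_le
  refine (lintegral_mono_ae h1).trans ?_
  rw [lintegral_const_mul']
  · gcongr
    refine (setLIntegral_abs_det_mul_comp_le volume hA (fun y hy => hf.2.1 y (hAB hy)) hN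
      hφm).trans ?_
    gcongr
    exact lintegral_shell_inv_norm_pow_le hn hm hΛ
  · exact ENNReal.ofReal_ne_top

theorem ofReal_rpow_le_tsum_dyadic {b t : ℝ} (hb : 0 ≤ b) (ht : 0 < t) (ht1 : t ≤ 1) :
    ENNReal.ofReal (t ^ b) ≤ ∑' j : ℕ,
      if (1 / 2 : ℝ) ^ (j + 1) < t then ENNReal.ofReal (((1 / 2 : ℝ) ^ j) ^ b) else 0 := by
  obtain ⟨j, hj1, hj2⟩ := exists_nat_pow_near_of_lt_one ht ht1 (by norm_num : (0 : ℝ) < 1 / 2)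
    (by norm_num)
  refine le_trans ?_ (ENNReal.le_tsum j)
  rw [if_pos hj1]
  gcongr

theorem tsum_dyadic_ne_top {a b C : ℝ} (hC : 0 < C) (hab : a < b) :
    ∑' j : ℕ, ENNReal.ofReal (((1 / 2 : ℝ) ^ j) ^ b) *
      ENNReal.ofReal (C / ((1 / 2 : ℝ) ^ (j + 5)) ^ a) ≠ ⊤ := by
  have h : ∀ j : ℕ, ENNReal.ofReal (((1 / 2 : ℝ) ^ j) ^ b) *
      ENNReal.ofReal (C / ((1 / 2 : ℝ) ^ (j + 5)) ^ a) =
        ENNReal.ofReal (C / ((1 / 2 : ℝ) ^ 5) ^ a * ((1 / 2 : ℝ) ^ (b - a)) ^ j) := by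
    intro j
    rw [← ENNReal.ofReal_mul (by positivity)]
    congr 1
    rw [pow_add, Real.mul_rpow (by positivity) (by positivity), ← Real.rpow_natCast (_ ^ (b - a)),
      ← Real.rpow_mul (by positivity), mul_comm (b - a), Real.rpow_mul (by positivity),
      Real.rpow_natCast, Real.rpow_sub (by positivity)]
    field_simp
  simp_rw [h]
  rw [← ENNReal.ofReal_tsum_of_nonneg (fun j => by positivity)]
  · exact ENNReal.ofReal_ne_top
  · refine Summable.mul_left _ (summable_geometric_of_lt_one (by positivity) ?_)
    exact Real.rpow_lt_one (by norm_num) (by norm_num) (by linarith)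

theorem norm_sub_le_of_mem_sector {n : ℕ} {ω₀ : sphere (0 : Vec n) 1} {δ b : ℝ}
    (hδ : δ ≤ 1) (hb : b ≤ 1) {y : Vec n}
    (hy : y ∈ sector (closedBall ω₀ δ) (1 - δ) b) :
    ‖(1 - δ) • ω₀.1 - y‖ ≤ 2 * δ ∧ 1 - δ < ‖y‖ ∧ ‖y‖ < b := by
  obtain ⟨ω, hω, r, hr, rfl⟩ := hy
  have h1 : ‖ω₀.1 - ω.1‖ ≤ δ := by
    have := mem_closedBall'.1 hω
    rwa [Subtype.dist_eq, dist_eq_norm] at this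
  have h2 : ‖ω.1‖ = 1 := by simp
  have hr0 : 0 ≤ r := by linarith [hr.1]
  have h3 : ‖r • ω.1‖ = r := by rw [norm_smul, h2, mul_one, Real.norm_of_nonneg hr0]
  rw [h3]
  refine ⟨?_, hr.1, hr.2⟩
  calc ‖(1 - δ) • ω₀.1 - r • ω.1‖ = ‖(1 - δ) • (ω₀.1 - ω.1) - (r - (1 - δ)) • ω.1‖ := by
        congr 1; module
    _ ≤ (1 - δ) * ‖ω₀.1 - ω.1‖ + (r - (1 - δ)) := by
        refine (norm_sub_le _ _).trans (le_of_eq ?_)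
        rw [norm_smul, norm_smul, h2, mul_one, Real.norm_of_nonneg (by linarith),
          Real.norm_of_nonneg (by linarith [hr.1])]
    _ ≤ 1 * δ + δ := by
        have := hr.2
        gcongr <;> linarith [norm_nonneg (ω₀.1 - ω.1)]
    _ = 2 * δ := by ring

theorem setLIntegral_sector_logGrad_le {n : ℕ} (hn : 2 ≤ n) {K a b C₁ : ℝ} (hK : 1 ≤ K)
    (hb : 0 ≤ b) {f : Vec n → Vec n} (hf : IsQR n K f)
    (hM : MultCond n a C₁ f) {m Λ δ : ℝ} (hm : 0 < m) (hΛ : 0 < Λ) (hδ : 0 < δ)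
    (hδ1 : δ ≤ 1 / 2) (ω₀ : sphere (0 : Vec n) 1) :
    ∫⁻ y in sector (closedBall ω₀ δ) (1 - δ) 1,
        logGrad f m Λ y ^ n * ENNReal.ofReal (((1 - ‖y‖) / δ) ^ b) ≤
      (∑' j : ℕ, ENNReal.ofReal (((1 / 2 : ℝ) ^ j) ^ b) *
        ENNReal.ofReal (C₁ / ((1 / 2 : ℝ) ^ (j + 5)) ^ a)) *
          (ENNReal.ofReal K * (ENNReal.ofReal Λ * (volume : Measure (Vec n)).toSphere univ)) := by
  set x : Vec n := (1 - δ) • ω₀.1 with hxdef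
  have hxn : ‖x‖ = 1 - δ := by
    rw [hxdef, norm_smul, Real.norm_of_nonneg (by linarith)]; simp
  have hx : x ∈ unitBall n := by
    rw [unitBall, mem_ball_zero_iff, hxn]; linarith
  set A : ℕ → Set (Vec n) := fun j =>
    sector (closedBall ω₀ δ) (1 - δ) (1 - δ * (1 / 2 : ℝ) ^ (j + 1)) with hA
  have hAm : ∀ j, MeasurableSet (A j) := fun j =>
    measurableSet_sector measurableSet_closedBall (by linarith)
  have hA1 : ∀ j, 1 - δ * (1 / 2 : ℝ) ^ (j + 1) ≤ 1 := fun j => by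
    have : 0 < δ * (1 / 2 : ℝ) ^ (j + 1) := by positivity
    linarith
  have hAB : ∀ j, A j ⊆ unitBall n := by
    intro j y hy
    rw [unitBall, mem_ball_zero_iff]
    exact (norm_sub_le_of_mem_sector (by linarith) (hA1 j) hy).2.2.trans_le (hA1 j)
  have hmult : ∀ j w, (({y ∈ A j | f y = w}.encard : ℕ∞) : ℝ≥0∞) ≤
      ENNReal.ofReal (C₁ / ((1 / 2 : ℝ) ^ (j + 5)) ^ a) := by
    intro j
    refine hM.encard_le hx (hAB j) (by positivity)
      (pow_lt_one₀ (by norm_num) (by norm_num) (by omega)) fun y hy => ?_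
    obtain ⟨h1, h2, h3⟩ := norm_sub_le_of_mem_sector (by linarith) (hA1 j) hy
    refine lt_of_lt_of_le ?_ (le_one_sub_norm_mobiusT hx (by linarith) (hAB j hy)
      (by rw [hxn]; linarith))
    rw [hxn, sub_sub_cancel, lt_div_iff₀ (by positivity)]
    calc (1 / 2 : ℝ) ^ (j + 5) * (16 * δ) = δ * (1 / 2) ^ (j + 1) := by ring
      _ < 1 - ‖y‖ := by linarith
  have hR : MeasurableSet (sector (closedBall ω₀ δ) (1 - δ) 1) :=
    measurableSet_sector measurableSet_closedBall (by linarith)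
  have hHm : Measurable fun y => logGrad f m Λ y ^ n := (measurable_logGrad hf.1 m Λ).pow_const n
  calc _ ≤ ∫⁻ y, ∑' j, ENNReal.ofReal (((1 / 2 : ℝ) ^ j) ^ b) *
            (A j).indicator (fun y => logGrad f m Λ y ^ n) y := by
        rw [← lintegral_indicator hR]
        refine lintegral_mono fun y => ?_
        by_cases hy : y ∈ sector (closedBall ω₀ δ) (1 - δ) 1
        · rw [indicator_of_mem hy]
          obtain ⟨h1, h2, h3⟩ := norm_sub_le_of_mem_sector (by linarith) le_rfl hy
          refine (mul_le_mul_right (ofReal_rpow_le_tsum_dyadic hb (t := (1 - ‖y‖) / δ)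
            (div_pos (by linarith) hδ) ((div_le_one hδ).2 (by linarith))) _).trans ?_
          rw [← ENNReal.tsum_mul_left]
          refine ENNReal.tsum_le_tsum fun j => ?_
          split_ifs with hj
          · rw [indicator_of_mem, mul_comm]
            obtain ⟨ω, hω, r, hr, rfl⟩ := hy
            refine ⟨ω, hω, r, ⟨hr.1, ?_⟩, rfl⟩
            rw [lt_div_iff₀ hδ, norm_smul, Real.norm_of_nonneg (by linarith [hr.1])] at hj
            have : ‖ω.1‖ = 1 := by simp
            rw [this] at hj
            linarith
          · simp
        · rw [indicator_of_notMem hy]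
          exact zero_le
    _ = ∑' j, ENNReal.ofReal (((1 / 2 : ℝ) ^ j) ^ b) * ∫⁻ y in A j, logGrad f m Λ y ^ n := by
        rw [lintegral_tsum fun j => ((hHm.indicator (hAm j)).const_mul _).aemeasurable]
        refine tsum_congr fun j => ?_
        rw [lintegral_const_mul _ (hHm.indicator (hAm j)), lintegral_indicator (hAm j)]
    _ ≤ ∑' j, ENNReal.ofReal (((1 / 2 : ℝ) ^ j) ^ b) *
          (ENNReal.ofReal K * (ENNReal.ofReal (C₁ / ((1 / 2 : ℝ) ^ (j + 5)) ^ a) *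
            (ENNReal.ofReal Λ * (volume : Measure (Vec n)).toSphere univ))) := by
        gcongr with j
        exact setLIntegral_logGrad_pow_le hn hK hf hm hΛ (hAm j) (hAB j) (hmult j)
    _ = _ := by
        rw [← ENNReal.tsum_mul_right]
        exact tsum_congr fun j => by ring

theorem ofReal_le_lintegral_logGrad {n : ℕ} {f : Vec n → Vec n} (hf : ContinuousOn f (unitBall n))
    (hd : ∀ x ∈ unitBall n, DifferentiableAt ℝ f x) (hf0 : ∀ x ∈ unitBall n, f x ≠ 0)
    {m Λ : ℝ} (hm : 0 < m) {ω : Vec n} (hω : ‖ω‖ = 1) {a b : ℝ}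
    (ha : 0 ≤ a) (hab : a ≤ b) (hb : b < 1) (hma : m ≤ ‖f (a • ω)‖)
    (hmb : ‖f (b • ω)‖ ≤ m * Real.exp (-Λ)) :
    ENNReal.ofReal Λ ≤ ∫⁻ r in Ioo a 1, logGrad f m Λ (r • ω) := by
  have hB : ∀ r ∈ Icc a b, r • ω ∈ unitBall n := fun r hr => by
    rw [unitBall, mem_ball_zero_iff, norm_smul, hω, mul_one,
      Real.norm_of_nonneg (ha.trans hr.1)]
    exact hr.2.trans_lt hb
  have hu : ContinuousOn (fun r : ℝ => ‖f (r • ω)‖) (Icc a b) :=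
    (hf.comp (by fun_prop) hB).norm
  obtain ⟨s, ⟨hs, hsm⟩, hs'⟩ : ∃ s, IsGreatest
      (Icc a b ∩ (fun r : ℝ => ‖f (r • ω)‖) ⁻¹' Ici m) s :=
    (isCompact_Icc.of_isClosed_subset (hu.preimage_isClosed_of_isClosed isClosed_Icc isClosed_Ici)
      inter_subset_left).exists_isGreatest ⟨a, ⟨le_rfl, hab⟩, hma⟩
  have hsb : Icc s b ⊆ Icc a b := Icc_subset_Icc_left hs.1
  obtain ⟨t, ⟨ht, htm⟩, ht'⟩ : ∃ t, IsLeast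
      (Icc s b ∩ (fun r : ℝ => ‖f (r • ω)‖) ⁻¹' Iic (m * Real.exp (-Λ))) t :=
    (isCompact_Icc.of_isClosed_subset
      ((hu.mono hsb).preimage_isClosed_of_isClosed isClosed_Icc isClosed_Iic)
      inter_subset_left).exists_isLeast ⟨b, ⟨hs.2, le_rfl⟩, hmb⟩
  have hst : Icc s t ⊆ Icc a b := Icc_subset_Icc hs.1 ht.2
  have hshell : ∀ r ∈ Ioo s t, r • ω ∈ levelShell f m Λ := by
    refine fun r hr => ⟨hB r (hst ⟨hr.1.le, hr.2.le⟩), ?_, ?_⟩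
    · by_contra! h
      exact absurd (ht' ⟨⟨hr.1.le, hr.2.le.trans ht.2⟩, h⟩) (not_le.2 hr.2)
    · by_contra! h
      exact absurd (hs' ⟨hst ⟨hr.1.le, hr.2.le⟩, h⟩) (not_le.2 hr.1)
  have hGm : Measurable fun r : ℝ => logGrad f m Λ (r • ω) :=
    (measurable_logGrad hf m Λ).comp (by fun_prop)
  have hsub : Ioo s t ⊆ Ioo a 1 := Ioo_subset_Ioo hs.1 (ht.2.trans hb.le)
  refine le_trans ?_ (lintegral_mono_set hsub)
  rw [restrict_Ioo_eq_restrict_Icc]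
  by_cases htop : ∫⁻ r in Icc s t, logGrad f m Λ (r • ω) = ⊤
  · rw [htop]; exact le_top
  have hlt : ∀ᵐ r ∂volume.restrict (Icc s t), logGrad f m Λ (r • ω) < ⊤ :=
    ae_lt_top hGm htop
  have hpos : ∀ r ∈ Icc s t, 0 < ‖f (r • ω)‖ := fun r hr => norm_pos_iff.2 (hf0 _ (hB r (hst hr)))
  have key := intervalIntegral.sub_le_integral_of_hasDeriv_right_of_le
    (g := fun r : ℝ => -(1 / 2) * Real.log (‖f (r • ω)‖ ^ 2))
    (g' := fun r : ℝ => -(1 / 2) * (2 * inner ℝ (f (r • ω)) (fderiv ℝ f (r • ω) ω) /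
      ‖f (r • ω)‖ ^ 2))
    (φ := fun r : ℝ => (logGrad f m Λ (r • ω)).toReal) ht.1 ?_ ?_ ?_ ?_
  · rw [← ENNReal.ofReal_toReal htop, ← integral_toReal hGm.aemeasurable hlt,
      integral_Icc_eq_integral_Ioc, ← intervalIntegral.integral_of_le ht.1]
    refine ENNReal.ofReal_le_ofReal (le_trans ?_ key)
    have h1 : Real.log m ≤ Real.log ‖f (s • ω)‖ := Real.log_le_log hm hsm
    have h2 : Real.log ‖f (t • ω)‖ ≤ Real.log m - Λ := by
      refine (Real.log_le_log (hpos t ⟨ht.1, le_rfl⟩) htm).trans (le_of_eq ?_)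
      rw [Real.log_mul hm.ne' (Real.exp_ne_zero _), Real.log_exp]; ring
    simp only [Real.log_pow]
    push_cast
    linarith
  · refine ContinuousOn.mul continuousOn_const (ContinuousOn.log ((hu.mono hst).pow 2) ?_)
    exact fun r hr => (pow_pos (hpos r hr) 2).ne'
  · intro r hr
    have hr' : r ∈ Icc s t := ⟨hr.1.le, hr.2.le⟩
    have h1 : HasDerivAt (fun r : ℝ => r • ω) ω r := by
      simpa using (hasDerivAt_id r).smul_const ω
    have h2 := (hd _ (hB r (hst hr'))).hasFDerivAt.comp_hasDerivAt r h1
    exact ((h2.norm_sq.log (pow_pos (hpos r hr') 2).ne').const_mul (-(1 / 2))).hasDerivWithinAt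
  · exact integrable_toReal_of_lintegral_ne_top hGm.aemeasurable htop
  · intro r hr
    have hr' : r ∈ Icc s t := ⟨hr.1.le, hr.2.le⟩
    have hp := hpos r hr'
    rw [logGrad, indicator_of_mem (hshell r hr), ENNReal.toReal_ofReal (by positivity)]
    have h1 := abs_real_inner_le_norm (f (r • ω)) (fderiv ℝ f (r • ω) ω)
    have h2 := (fderiv ℝ f (r • ω)).le_opNorm ω
    rw [hω, mul_one] at h2
    have h3 := neg_abs_le (inner ℝ (f (r • ω)) (fderiv ℝ f (r • ω) ω))
    have h4 := mul_le_mul_of_nonneg_left h2 hp.le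
    rw [show -(1 / 2) * (2 * inner ℝ (f (r • ω)) (fderiv ℝ f (r • ω) ω) / ‖f (r • ω)‖ ^ 2) =
      -inner ℝ (f (r • ω)) (fderiv ℝ f (r • ω) ω) / ‖f (r • ω)‖ ^ 2 by ring,
      div_le_div_iff₀ (by positivity) hp]
    nlinarith

theorem lintegral_Ioo_pow_le {n : ℕ} (hn : 2 ≤ n) {b δ : ℝ} (hb : 0 ≤ b) (hbn : b < (n : ℝ) - 1)
    (hδ : 0 < δ) {h : ℝ → ℝ≥0∞} (hh : Measurable h) :
    (∫⁻ r in Ioo (1 - δ) 1, h r) ^ n ≤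
      (∫⁻ r in Ioo (1 - δ) 1, h r ^ n * ENNReal.ofReal (((1 - r) / δ) ^ b)) *
        ENNReal.ofReal (δ / (1 - b / ((n : ℝ) - 1))) ^ (n - 1) := by
  have hn2 : (2 : ℝ) ≤ n := by exact_mod_cast hn
  have hnn : (n : ℝ) - 1 = ((n - 1 : ℕ) : ℝ) := by
    rw [Nat.cast_sub (by omega)]; simp
  set N : ℝ := (n : ℝ) with hN
  have hpq : N.HolderConjugate (N / (N - 1)) := Real.HolderConjugate.conjExponent (by linarith)
  have hβ : b / (N - 1) < 1 := by rw [div_lt_one (by linarith)]; exact hbn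
  have hI : ∫⁻ r in Ioo (1 - δ) 1, ENNReal.ofReal (((1 - r) / δ) ^ (-(b / (N - 1)))) =
      ENNReal.ofReal (δ / (1 - b / (N - 1))) := by
    have hd : ∀ r : ℝ, (1 - r) / δ = 1 / δ - r / δ := fun r => by ring
    have hint : ∫ r in (1 - δ)..1, ((1 - r) / δ) ^ (-(b / (N - 1))) = δ / (1 - b / (N - 1)) := by
      simp_rw [hd]
      rw [intervalIntegral.integral_comp_sub_div (fun t : ℝ => t ^ (-(b / (N - 1)))) hδ.ne',
        sub_self, ← hd, sub_sub_cancel, div_self hδ.ne', integral_rpow (Or.inl (by linarith)),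
        Real.one_rpow, Real.zero_rpow (by linarith), smul_eq_mul]
      ring
    have hne : δ / (1 - b / (N - 1)) ≠ 0 := (div_pos hδ (by linarith)).ne'
    rw [← hint, intervalIntegral.integral_of_le (by linarith), restrict_Ioo_eq_restrict_Ioc,
      ofReal_integral_eq_lintegral_ofReal]
    · exact (intervalIntegral.intervalIntegrable_of_integral_ne_zero (by rwa [hint])).1
    · refine (ae_restrict_iff' measurableSet_Ioc).2 (.of_forall fun r hr => ?_)
      exact Real.rpow_nonneg (div_nonneg (by linarith [hr.2]) hδ.le) _
  have hH := ENNReal.lintegral_mul_le_Lp_mul_Lq (volume.restrict (Ioo (1 - δ) 1)) hpq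
    (f := fun r => h r * ENNReal.ofReal (((1 - r) / δ) ^ (b / N)))
    (g := fun r => ENNReal.ofReal (((1 - r) / δ) ^ (-(b / N))))
    (Measurable.aemeasurable (by fun_prop)) (Measurable.aemeasurable (by fun_prop))
  have h1 : ∫⁻ r in Ioo (1 - δ) 1, h r = ∫⁻ r in Ioo (1 - δ) 1,
      ((fun r => h r * ENNReal.ofReal (((1 - r) / δ) ^ (b / N))) *
        fun r => ENNReal.ofReal (((1 - r) / δ) ^ (-(b / N)))) r := by
    refine setLIntegral_congr_fun measurableSet_Ioo fun r hr => ?_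
    have : 0 < (1 - r) / δ := div_pos (by linarith [hr.2]) hδ
    simp only [Pi.mul_apply]
    rw [mul_assoc, ← ENNReal.ofReal_mul (by positivity), ← Real.rpow_add this]
    simp
  have h2 : ∫⁻ r in Ioo (1 - δ) 1, (h r * ENNReal.ofReal (((1 - r) / δ) ^ (b / N))) ^ N =
      ∫⁻ r in Ioo (1 - δ) 1, h r ^ n * ENNReal.ofReal (((1 - r) / δ) ^ b) := by
    refine setLIntegral_congr_fun measurableSet_Ioo fun r hr => ?_
    have : 0 < (1 - r) / δ := div_pos (by linarith [hr.2]) hδ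
    rw [ENNReal.mul_rpow_of_nonneg _ _ (by linarith), hN, ENNReal.rpow_natCast, ← hN,
      ENNReal.ofReal_rpow_of_pos (by positivity), ← Real.rpow_mul this.le,
      div_mul_cancel₀ _ (by linarith)]
  have h3 : ∫⁻ r in Ioo (1 - δ) 1, ENNReal.ofReal (((1 - r) / δ) ^ (-(b / N))) ^ (N / (N - 1)) =
      ENNReal.ofReal (δ / (1 - b / (N - 1))) := by
    rw [← hI]
    refine setLIntegral_congr_fun measurableSet_Ioo fun r hr => ?_
    have : 0 < (1 - r) / δ := div_pos (by linarith [hr.2]) hδ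
    have hN1 : N - 1 ≠ 0 := by linarith
    have hN0 : N ≠ 0 := by linarith
    rw [ENNReal.ofReal_rpow_of_pos (by positivity), ← Real.rpow_mul this.le]
    congr 2
    field_simp
  rw [← h1, h2, h3] at hH
  refine (pow_le_pow_left' hH n).trans (le_of_eq ?_)
  rw [mul_pow, ← ENNReal.rpow_natCast, ← ENNReal.rpow_mul, ← hN, one_div_mul_cancel (by linarith),
    ENNReal.rpow_one, ← ENNReal.rpow_natCast, ← ENNReal.rpow_mul, ← hN, ← ENNReal.rpow_natCast,
    ← hnn]
  congr 2
  have hN0 : N ≠ 0 := by linarith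
  field_simp

theorem toSphere_setOf_exists_norm_le {n : ℕ} (hn : 2 ≤ n) {K a b C₁ : ℝ} (hK : 1 ≤ K)
    (hb : 0 ≤ b) (hbn : b < (n : ℝ) - 1) {f : Vec n → Vec n} (hf : IsQR n K f)
    (hf0 : ∀ x ∈ unitBall n, f x ≠ 0) (hM : MultCond n a C₁ f) {m Λ δ : ℝ} (hm : 0 < m)
    (hΛ : 0 < Λ) (hδ : 0 < δ) (hδ1 : δ ≤ 1 / 2) (ω₀ : sphere (0 : Vec n) 1)
    (hcap : ∀ ω ∈ closedBall ω₀ δ, m ≤ ‖f ((1 - δ) • ω.1)‖) :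
    ENNReal.ofReal Λ ^ n * (volume : Measure (Vec n)).toSphere
        {ω ∈ closedBall ω₀ δ | ∃ r ∈ Ico (1 - δ) 1, ‖f (r • ω.1)‖ ≤ m * Real.exp (-Λ)} ≤
      ENNReal.ofReal (δ / (1 - b / ((n : ℝ) - 1))) ^ (n - 1) * (2 ^ (n - 1) *
        ((∑' j : ℕ, ENNReal.ofReal (((1 / 2 : ℝ) ^ j) ^ b) *
          ENNReal.ofReal (C₁ / ((1 / 2 : ℝ) ^ (j + 5)) ^ a)) *
            (ENNReal.ofReal K *
              (ENNReal.ofReal Λ * (volume : Measure (Vec n)).toSphere univ)))) := by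
  have : Nontrivial (Fin n) := Fin.nontrivial_iff_two_le.2 hn
  set c := ENNReal.ofReal (δ / (1 - b / ((n : ℝ) - 1))) ^ (n - 1)
  set h : Vec n → ℝ≥0∞ := fun y => logGrad f m Λ y ^ n * ENNReal.ofReal (((1 - ‖y‖) / δ) ^ b)
    with hh
  have hG := measurable_logGrad hf.1 m Λ
  have hhm : Measurable h := by fun_prop
  set τ := (volume : Measure (Vec n)).toSphere
  set H : sphere (0 : Vec n) 1 → ℝ≥0∞ := fun ω =>
    ∫⁻ r in Ioo (1 - δ) 1, ENNReal.ofReal (r ^ (n - 1)) * h (r • ω.1) with hH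
  have hHm : Measurable H := by
    refine Measurable.lintegral_prod_right' (ν := volume.restrict (Ioo (1 - δ) 1))
      (f := fun q : sphere (0 : Vec n) 1 × ℝ => ENNReal.ofReal (q.2 ^ (n - 1)) * h (q.2 • q.1.1)) ?_
    exact Measurable.mul (by fun_prop) (hhm.comp (by fun_prop))
  have hpt : ∀ ω ∈ closedBall ω₀ δ, (∃ r ∈ Ico (1 - δ) 1, ‖f (r • ω.1)‖ ≤ m * Real.exp (-Λ)) →
      ENNReal.ofReal Λ ^ n ≤ c * (2 ^ (n - 1) * H ω) := by
    rintro ω hω ⟨r, hr, hfr⟩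
    have hω1 : ‖ω.1‖ = 1 := by simp
    have h1 := ofReal_le_lintegral_logGrad hf.1 hf.2.1 hf0 hm hω1 (by linarith) hr.1 hr.2
      (hcap ω hω) hfr
    have h2 := lintegral_Ioo_pow_le hn hb hbn hδ (h := fun r => logGrad f m Λ (r • ω.1))
      (hG.comp (by fun_prop))
    refine (pow_le_pow_left' h1 n).trans (h2.trans ?_)
    rw [mul_comm, hH, ← lintegral_const_mul' (2 ^ (n - 1)) _ (by finiteness)]
    refine mul_le_mul_right (setLIntegral_mono_ae' measurableSet_Ioo (.of_forall fun r hr => ?_)) _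
    have hr0 : 0 ≤ r := by linarith [hr.1]
    have h3 : (1 : ℝ≥0∞) ≤ 2 ^ (n - 1) * ENNReal.ofReal (r ^ (n - 1)) := by
      rw [ENNReal.ofReal_pow hr0, ← mul_pow]
      refine one_le_pow₀ ?_
      rw [← ENNReal.ofReal_ofNat 2, ← ENNReal.ofReal_mul (by norm_num)]
      exact ENNReal.one_le_ofReal.2 (by linarith [hr.1])
    rw [← mul_assoc]
    refine le_trans (le_of_eq ?_) (le_mul_of_one_le_left' h3)
    rw [hh]
    simp only
    rw [norm_smul, hω1, mul_one, Real.norm_of_nonneg hr0]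
  calc _ ≤ ENNReal.ofReal Λ ^ n * (τ.restrict (closedBall ω₀ δ))
          {ω | ENNReal.ofReal Λ ^ n ≤ c * (2 ^ (n - 1) * H ω)} := by
        rw [Measure.restrict_apply (measurableSet_le measurable_const (by fun_prop))]
        gcongr
        exact fun ω hω => ⟨hpt ω hω.1 hω.2, hω.1⟩
    _ ≤ ∫⁻ ω in closedBall ω₀ δ, c * (2 ^ (n - 1) * H ω) ∂τ :=
        mul_meas_ge_le_lintegral (by fun_prop) _
    _ = c * (2 ^ (n - 1) * ∫⁻ y in sector (closedBall ω₀ δ) (1 - δ) 1, h y) := by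
        rw [lintegral_const_mul _ (by fun_prop), lintegral_const_mul _ hHm,
          setLIntegral_sector volume measurableSet_closedBall (by linarith) hhm,
          finrank_euclideanSpace_fin]
    _ ≤ _ := by
        gcongr
        exact setLIntegral_sector_logGrad_le hn hK hb hf hM hm hΛ hδ hδ1 ω₀

theorem exists_le_mul_sphMeasure_radial_lower_bound {n : ℕ} (hn : 2 ≤ n) {K C₀ α a C₁ : ℝ}
    (hK : 1 ≤ K) (hC₀ : 1 ≤ C₀) (hα : 0 < α) (ha0 : 0 ≤ a) (ha : a < (n : ℝ) - 1) (hC₁ : 0 < C₁)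
    {f : Vec n → Vec n} (hf : IsQR n K f) (hf0 : ∀ x ∈ unitBall n, f x ≠ 0)
    (hMin : InMiniowitz n C₀ α f) (hM : MultCond n a C₁ f) :
    ∃ c > 0, ∃ C : ℝ≥0∞, C ≠ ⊤ ∧ ∀ x : Vec n, 1 / 2 ≤ ‖x‖ → ‖x‖ < 1 →
      ENNReal.ofReal ((1 - ‖x‖) ^ (n - 1)) ≤
        C * sphMeasure n {ω ∈ unitSphere n | ∀ r ∈ Ico ‖x‖ 1, c * ‖f x‖ ≤ ‖f (r • ω)‖} := by
  have : Nontrivial (Fin n) := Fin.nontrivial_iff_two_le.2 hn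
  obtain ⟨b, hab, hbn⟩ := exists_between ha
  have hb : 0 ≤ b := ha0.trans hab.le
  have hn2 : (2 : ℝ) ≤ n := by exact_mod_cast hn
  have hβ : 0 < 1 - b / ((n : ℝ) - 1) := by
    rw [sub_pos, div_lt_one (by linarith)]; exact hbn
  set τ := (volume : Measure (Vec n)).toSphere
  set E : ℝ≥0∞ := ENNReal.ofReal (1 / (1 - b / ((n : ℝ) - 1))) ^ (n - 1) * (2 ^ (n - 1) *
    ((∑' j : ℕ, ENNReal.ofReal (((1 / 2 : ℝ) ^ j) ^ b) *
      ENNReal.ofReal (C₁ / ((1 / 2 : ℝ) ^ (j + 5)) ^ a)) * (ENNReal.ofReal K * τ univ)))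
    with hE
  have hEt : E ≠ ⊤ := by
    have := tsum_dyadic_ne_top hC₁ hab
    have h2 : τ univ ≠ ⊤ := measure_ne_top _ _
    rw [hE]
    finiteness
  set κ : ℝ≥0∞ := ENNReal.ofReal ((1 / 8) ^ n) * volume (closedBall (0 : Vec n) 1) with hκ
  have hκ0 : κ ≠ 0 := mul_ne_zero (by simp) (measure_closedBall_pos _ _ one_pos).ne'
  have hκt : κ ≠ ⊤ := ENNReal.mul_ne_top ENNReal.ofReal_ne_top measure_closedBall_lt_top.ne
  have hκ20 : κ / 2 ≠ 0 := by simp [hκ0]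
  have hκ2t : κ / 2 ≠ ⊤ := by finiteness
  set Λ : ℝ := max 1 (E / (κ / 2)).toReal with hΛdef
  have hΛ1 : 1 ≤ Λ := le_max_left _ _
  have hEΛ : E ≤ ENNReal.ofReal Λ * (κ / 2) := by
    rw [← ENNReal.div_le_iff hκ20 hκ2t]
    exact ENNReal.le_ofReal_iff_toReal_le (ENNReal.div_ne_top hEt hκ20) (by linarith) |>.2
      (le_max_right _ _)
  have hΛ0 : ENNReal.ofReal Λ ≠ 0 := by simp; linarith
  obtain ⟨C, hC, hCS⟩ := toSphere_le_sphMeasure hn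
  refine ⟨C₀⁻¹ * (1 / 32) ^ α * Real.exp (-Λ), by positivity, (κ / 2)⁻¹ * C, by finiteness,
    fun x hx2 hx1 => ?_⟩
  have hx0 : 0 < ‖x‖ := by linarith
  have hxB : x ∈ unitBall n := by rwa [unitBall, mem_ball_zero_iff]
  set ω₀ : sphere (0 : Vec n) 1 := ⟨‖x‖⁻¹ • x, by simp [norm_smul, hx0.ne']⟩ with hω₀
  set δ : ℝ := 1 - ‖x‖ with hδdef
  have hδ : 0 < δ := by linarith
  have hδ2 : δ ≤ 1 / 2 := by linarith
  have h1δ : 1 - δ = ‖x‖ := by rw [hδdef]; ring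
  set m : ℝ := C₀⁻¹ * (1 / 32) ^ α * ‖f x‖ with hm
  have hm0 : 0 < m := by
    have := norm_pos_iff.2 (hf0 x hxB)
    positivity
  have hcap : ∀ ω ∈ closedBall ω₀ δ, m ≤ ‖f ((1 - δ) • ω.1)‖ := by
    intro ω hω
    have hω1 : ‖ω.1‖ = 1 := by simp
    rw [h1δ]
    refine hMin.le_norm hC₀ hα hf0 hxB ?_ ?_
    · rw [norm_smul, hω1, mul_one, norm_norm]
    · have h1 : ‖ω₀.1 - ω.1‖ ≤ δ := by
        have := mem_closedBall'.1 hω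
        rwa [Subtype.dist_eq, dist_eq_norm] at this
      have h2 : x - ‖x‖ • ω.1 = ‖x‖ • (ω₀.1 - ω.1) := by
        rw [smul_sub, hω₀, smul_inv_smul₀ hx0.ne']
      rw [h2, norm_smul, norm_norm]
      nlinarith
  set F : Set (sphere (0 : Vec n) 1) :=
    {ω ∈ closedBall ω₀ δ | ∃ r ∈ Ico (1 - δ) 1, ‖f (r • ω.1)‖ ≤ m * Real.exp (-Λ)} with hF
  set d : ℝ≥0∞ := ENNReal.ofReal (δ ^ (n - 1)) with hd
  have hFle : τ F ≤ κ / 2 * d := by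
    have h1 := toSphere_setOf_exists_norm_le hn hK hb hbn hf hf0 hM hm0 (by linarith) hδ hδ2 ω₀ hcap
      (Λ := Λ)
    have h2 : ENNReal.ofReal Λ * (ENNReal.ofReal Λ * τ F) ≤ ENNReal.ofReal Λ * (E * d) := by
      calc _ = ENNReal.ofReal Λ ^ 2 * τ F := by ring
        _ ≤ ENNReal.ofReal Λ ^ n * τ F := by
          gcongr
          exact ENNReal.one_le_ofReal.2 hΛ1
        _ ≤ _ := h1
        _ = _ := by
          rw [hE, hd, ENNReal.ofReal_pow hδ.le, div_eq_mul_one_div δ,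
            ENNReal.ofReal_mul hδ.le, mul_pow]
          ring
    have h3 := (ENNReal.mul_le_mul_iff_right hΛ0 ENNReal.ofReal_ne_top).1 h2
    have h4 : ENNReal.ofReal Λ * τ F ≤ ENNReal.ofReal Λ * (κ / 2 * d) := by
      refine h3.trans ?_
      rw [← mul_assoc]
      gcongr
    exact (ENNReal.mul_le_mul_iff_right hΛ0 ENNReal.ofReal_ne_top).1 h4
  have hcapm : κ * d ≤ τ (closedBall ω₀ δ) := by
    have := le_toSphere_closedBall (volume : Measure (Vec n)) ω₀ hδ hδ2
    rwa [finrank_euclideanSpace_fin] at this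
  have hdiff : κ / 2 * d ≤ τ (closedBall ω₀ δ \ F) := by
    refine ENNReal.le_of_add_le_add_left (a := κ / 2 * d) (by finiteness) ?_
    rw [← add_mul, ENNReal.add_halves]
    refine hcapm.trans ((measure_le_inter_add_sdiff τ _ F).trans ?_)
    gcongr
    exact (measure_mono inter_subset_right).trans hFle
  rw [mul_assoc, ← ENNReal.mul_le_iff_le_inv hκ20 hκ2t]
  refine hdiff.trans ((hCS _).trans ?_)
  gcongr
  rintro _ ⟨ω, ⟨hω, hωF⟩, rfl⟩
  refine ⟨ω.2, fun r hr => ?_⟩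
  by_contra! h
  refine hωF ⟨hω, r, by rwa [h1δ], ?_⟩
  rw [hm]
  linarith

theorem iSup_ofReal_closedBall_lt_top {n : ℕ} {u : Vec n → ℝ} (hu : ContinuousOn u (unitBall n))
    {r : ℝ} (hr : r < 1) : ⨆ x ∈ closedBall (0 : Vec n) r, ENNReal.ofReal (u x) < ⊤ := by
  obtain ⟨N, hN⟩ := (isCompact_closedBall (0 : Vec n) r).exists_bound_of_continuousOn
    (hu.mono (closedBall_subset_ball hr))
  refine lt_of_le_of_lt (iSup₂_le fun x hx => ?_) (ENNReal.ofReal_lt_top (r := N))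
  exact ENNReal.ofReal_le_ofReal ((le_abs_self _).trans (hN x hx))

theorem lintegral_mul_iSup_sphere_lt_top {n : ℕ} (hn : 2 ≤ n) {u : Vec n → ℝ}
    (hu : ContinuousOn u (unitBall n)) {c : ℝ} (hc : 0 < c) {C A : ℝ≥0∞}
    (hC : C ≠ ⊤) (hA : A ≠ ⊤)
    (huC : ∀ x : Vec n, 1 / 2 ≤ ‖x‖ → ‖x‖ < 1 → ENNReal.ofReal ((1 - ‖x‖) ^ (n - 1)) ≤
        C * sphMeasure n {ω ∈ unitSphere n | ∀ r ∈ Ico ‖x‖ 1, c * u x ≤ u (r • ω)})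
    (huA : ∀ r ∈ Ioo (0 : ℝ) 1, ∫⁻ ω, ENNReal.ofReal (u (r • ω)) ∂(sphMeasure n) ≤ A) :
    ∫⁻ r in Ioo (0 : ℝ) 1, ENNReal.ofReal ((1 - r) ^ (n - 2)) *
      ⨆ x ∈ sphere (0 : Vec n) r, ENNReal.ofReal (u x) < ⊤ := by
  set S : ℝ → ℝ≥0∞ := fun r => ⨆ x ∈ sphere (0 : Vec n) r, ENNReal.ofReal (u x) with hS
  set T : ℝ → Set (Vec n) := fun r => {x | 1 / 2 ≤ ‖x‖ ∧ ‖x‖ ≤ r} with hT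
  set M : ℝ → ℝ≥0∞ := fun r => ⨆ x ∈ T r, ENNReal.ofReal (u x) with hMdef
  have hMmono : Monotone M := fun r s hrs =>
    biSup_mono fun x hx => ⟨hx.1, hx.2.trans hrs⟩
  have hMt : ∀ r < 1, M r < ⊤ := fun r hr =>
    lt_of_le_of_lt (biSup_mono fun x hx => by simpa using hx.2)
      (iSup_ofReal_closedBall_lt_top hu hr)
  set ρ : ℕ → ℝ := fun j => 1 - 1 / ((j : ℝ) + 2) with hρ
  have hρ01 : ∀ j, ρ j ∈ Ioo (0 : ℝ) 1 := fun j => by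
    have h1 : (0 : ℝ) < 1 / ((j : ℝ) + 2) := by positivity
    have h2 : 1 / ((j : ℝ) + 2) < 1 := by
      rw [div_lt_one (by positivity)]; linarith [(Nat.cast_nonneg j : (0 : ℝ) ≤ j)]
    exact ⟨by simp only [hρ]; linarith, by simp only [hρ]; linarith⟩
  have hρ1 : Tendsto ρ atTop (𝓝 1) := by
    have h1 := (tendsto_one_div_add_atTop_nhds_zero_nat (𝕜 := ℝ)).comp (tendsto_add_atTop_nat 1)
    have h2 := h1.const_sub 1
    rw [sub_zero] at h2
    refine h2.congr fun j => ?_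
    simp only [Function.comp, hρ]
    push_cast
    ring
  have hvm : Measurable ((unitBall n).piecewise u 0) :=
    hu.measurable_piecewise continuousOn_const measurableSet_ball
  set w : Vec n → ℝ≥0∞ := fun ω =>
    liminf (fun j => ENNReal.ofReal ((unitBall n).piecewise u 0 (ρ j • ω))) atTop with hw
  have hwm : Measurable w := Measurable.liminf fun j =>
    (hvm.comp (by fun_prop : Measurable fun ω : Vec n => ρ j • ω)).ennreal_ofReal
  have hball : ∀ j, ∀ ω ∈ unitSphere n, ρ j • ω ∈ unitBall n := fun j ω hω => by
    rw [unitSphere, mem_sphere_zero_iff_norm] at hω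
    rw [unitBall, mem_ball_zero_iff, norm_smul, hω, mul_one, Real.norm_of_nonneg (hρ01 j).1.le]
    exact (hρ01 j).2
  have hsm : MeasurableSet (unitSphere n) := isClosed_sphere.measurableSet
  have hwA : ∫⁻ ω, w ω ∂(sphMeasure n) ≤ A := by
    refine (lintegral_liminf_le fun j =>
      (hvm.comp (by fun_prop : Measurable fun ω : Vec n => ρ j • ω)).ennreal_ofReal).trans ?_
    refine liminf_le_of_le (by isBoundedDefault) fun b hb => ?_
    obtain ⟨j, hj⟩ := hb.exists
    refine hj.trans ((le_of_eq ?_).trans (huA (ρ j) (hρ01 j)))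
    refine setLIntegral_congr_fun hsm fun ω hω => ?_
    rw [Function.comp_apply, piecewise_eq_of_mem _ _ _ (hball j ω hω)]
  have hwt : ∀ᵐ ω ∂(sphMeasure n), w ω < ⊤ := ae_lt_top hwm (ne_top_of_le_ne_top hA hwA)
  set μ : Measure ℝ := (volume.restrict (Ico (1 / 2) 1)).withDensity
    fun r => ENNReal.ofReal ((1 - r) ^ (n - 2)) with hμ
  have hlevel : ∀ s : ℝ, 0 < s → μ {r | s < (M r).toReal} ≤
      2 ^ (n - 1) * C * sphMeasure n {ω | s ≤ (w ω).toReal / c} := by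
    intro s hs
    set L : Set ℝ := {t | ∃ x : Vec n, 1 / 2 ≤ ‖x‖ ∧ ‖x‖ = t ∧ t < 1 ∧ s < u x} with hL
    have hex : ∀ r < 1, s < (M r).toReal → ∃ t ∈ L, t ≤ r := by
      intro r hr hsr
      have : ENNReal.ofReal s < M r := (ENNReal.ofReal_lt_iff_lt_toReal hs.le (hMt r hr).ne).2 hsr
      simp only [hMdef, lt_iSup_iff] at this
      obtain ⟨x, hx, hsx⟩ := this
      exact ⟨‖x‖, ⟨x, hx.1, rfl, hx.2.trans_lt hr,
        (ENNReal.ofReal_lt_ofReal_iff_of_nonneg hs.le).1 hsx⟩, hx.2⟩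
    have hmL : MeasurableSet {r | s < (M r).toReal} :=
      measurableSet_lt measurable_const hMmono.measurable.ennreal_toReal
    rw [hμ, withDensity_apply _ hmL, Measure.restrict_restrict hmL]
    rcases L.eq_empty_or_nonempty with hLe | hLne
    · have : {r | s < (M r).toReal} ∩ Ico (1 / 2) 1 = ∅ := by
        refine eq_empty_of_forall_notMem fun r hr => ?_
        obtain ⟨t, ht, -⟩ := hex r hr.2.2 hr.1
        rw [hLe] at ht
        exact ht
      rw [this]
      simp
    have hLb : BddBelow L := ⟨1 / 2, fun t ⟨x, hx, hxt, _⟩ => hxt ▸ hx⟩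
    set σ := sInf L with hσ
    have hσ1 : σ < 1 := by
      obtain ⟨t, ht⟩ := hLne
      obtain ⟨x, _, _, h1, _⟩ := id ht
      exact (csInf_le hLb ht).trans_lt h1
    obtain ⟨t, ⟨x, hx2, rfl, hx1, hsx⟩, hxσ⟩ :=
      exists_lt_of_csInf_lt hLne (show sInf L < σ + (1 - σ) / 2 by linarith)
    have hsub : {r | s < (M r).toReal} ∩ Ico (1 / 2) 1 ⊆ Ico σ 1 := fun r hr => by
      obtain ⟨t, ht, htr⟩ := hex r hr.2.2 hr.1
      exact ⟨(csInf_le hLb ht).trans htr, hr.2.2⟩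
    calc _ ≤ ∫⁻ r in Ico σ 1, ENNReal.ofReal ((1 - σ) ^ (n - 2)) := by
          refine (lintegral_mono_set hsub).trans ?_
          refine setLIntegral_mono measurable_const fun r hr => ?_
          have := hr.2
          exact ENNReal.ofReal_le_ofReal (pow_le_pow_left₀ (by linarith) (by linarith [hr.1]) _)
      _ = ENNReal.ofReal ((1 - σ) ^ (n - 1)) := by
          rw [setLIntegral_const, Real.volume_Ico,
            ← ENNReal.ofReal_mul (pow_nonneg (by linarith) _), ← pow_succ]
          congr 3
          omega
      _ ≤ ENNReal.ofReal ((2 * (1 - ‖x‖)) ^ (n - 1)) :=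
          ENNReal.ofReal_le_ofReal (pow_le_pow_left₀ (by linarith) (by linarith) _)
      _ = 2 ^ (n - 1) * ENNReal.ofReal ((1 - ‖x‖) ^ (n - 1)) := by
          rw [mul_pow, ENNReal.ofReal_mul (by positivity), ENNReal.ofReal_pow (by norm_num)]
          simp
      _ ≤ 2 ^ (n - 1) * (C * _) := by gcongr; exact huC x hx2 hx1
      _ ≤ _ := by
          rw [← mul_assoc]
          refine mul_le_mul_right (measure_mono_ae ?_) _
          filter_upwards [hwt] with ω hωt hω
          change ω ∈ {ω ∈ unitSphere n | ∀ r ∈ Ico ‖x‖ 1, c * u x ≤ u (r • ω)} at hω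
          change s ≤ (w ω).toReal / c
          rw [le_div_iff₀ hc, ← ENNReal.ofReal_le_iff_le_toReal hωt.ne]
          refine le_liminf_of_le (by isBoundedDefault) ?_
          filter_upwards [hρ1.eventually (lt_mem_nhds hx1)] with j hj
          rw [piecewise_eq_of_mem _ _ _ (hball j ω hω.1)]
          refine ENNReal.ofReal_le_ofReal (le_trans ?_ (hω.2 _ ⟨hj.le, (hρ01 j).2⟩))
          nlinarith
  have houter : ∫⁻ r in Ico (1 / 2 : ℝ) 1, ENNReal.ofReal ((1 - r) ^ (n - 2)) * S r < ⊤ := by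
    have hdm : Measurable fun r : ℝ => ENNReal.ofReal ((1 - r) ^ (n - 2)) := by fun_prop
    calc _ ≤ ∫⁻ r in Ico (1 / 2 : ℝ) 1, ENNReal.ofReal ((1 - r) ^ (n - 2)) *
            ENNReal.ofReal (M r).toReal := by
          refine setLIntegral_mono' measurableSet_Ico fun r hr => ?_
          rw [ENNReal.ofReal_toReal (hMt r hr.2).ne]
          refine mul_le_mul_right (biSup_mono fun x hx => ?_) _
          rw [mem_sphere_zero_iff_norm] at hx
          exact ⟨hx ▸ hr.1, hx.le⟩
      _ = ∫⁻ r, ENNReal.ofReal (M r).toReal ∂μ := by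
          rw [hμ, lintegral_withDensity_eq_lintegral_mul _ hdm
            hMmono.measurable.ennreal_toReal.ennreal_ofReal]
          rfl
      _ = ∫⁻ s in Ioi 0, μ {r | s < (M r).toReal} :=
          lintegral_eq_lintegral_meas_lt μ (.of_forall fun _ => ENNReal.toReal_nonneg)
            hMmono.measurable.ennreal_toReal.aemeasurable
      _ ≤ ∫⁻ s in Ioi 0, 2 ^ (n - 1) * C * sphMeasure n {ω | s ≤ (w ω).toReal / c} :=
          setLIntegral_mono' measurableSet_Ioi hlevel
      _ = 2 ^ (n - 1) * C * ∫⁻ ω, ENNReal.ofReal ((w ω).toReal / c) ∂(sphMeasure n) := by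
          rw [lintegral_const_mul' _ _ (by finiteness), lintegral_eq_lintegral_meas_le
            (sphMeasure n) (.of_forall fun _ => div_nonneg ENNReal.toReal_nonneg hc.le)
            (by fun_prop)]
      _ ≤ 2 ^ (n - 1) * C * (A * ENNReal.ofReal c⁻¹) := by
          gcongr
          simp_rw [div_eq_mul_inv, ENNReal.ofReal_mul ENNReal.toReal_nonneg]
          rw [lintegral_mul_const' _ _ (by finiteness)]
          gcongr
          exact (lintegral_mono fun ω => ENNReal.ofReal_toReal_le).trans hwA
      _ < ⊤ := by finiteness
  have hinner : ∫⁻ r in Ioo (0 : ℝ) (1 / 2), ENNReal.ofReal ((1 - r) ^ (n - 2)) * S r < ⊤ := by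
    refine lt_of_le_of_lt (setLIntegral_mono' (g := fun _ =>
      ⨆ x ∈ closedBall (0 : Vec n) (1 / 2), ENNReal.ofReal (u x)) measurableSet_Ioo
        fun r hr => ?_) ?_
    · refine (mul_le_of_le_one_left' ?_).trans (biSup_mono fun x hx => ?_)
      · exact ENNReal.ofReal_le_one.2 (pow_le_one₀ (by linarith [hr.2]) (by linarith [hr.1]))
      · exact (sphere_subset_closedBall.trans (closedBall_subset_closedBall hr.2.le)) hx
    · rw [setLIntegral_const]
      exact ENNReal.mul_lt_top (iSup_ofReal_closedBall_lt_top hu (by norm_num)) (by simp)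
  rw [← Ioo_union_Ico_eq_Ioo (show (0 : ℝ) < 1 / 2 by norm_num) (by norm_num)]
  exact (lintegral_union_le _ _ _).trans_lt (ENNReal.add_lt_top.2 ⟨hinner, houter⟩)

theorem MemHp.exists_lintegral_le {n : ℕ} (hn : 2 ≤ n) {p : ℝ} (hp : 0 < p) {f : Vec n → Vec n}
    (hf : MemHp n p f) : ∃ A : ℝ≥0∞, A ≠ ⊤ ∧ ∀ r ∈ Ioo (0 : ℝ) 1,
      ∫⁻ ω, ENNReal.ofReal (‖f (r • ω)‖ ^ p) ∂(sphMeasure n) ≤ A := by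
  have hσ := sphMeasure_unitSphere_lt_top hn
  have h1 : (⨆ r ∈ Ioo (0 : ℝ) 1, hardyMean n p f r) < ⊤ := by
    rw [MemHp, hardyNorm] at hf
    by_contra h
    rw [not_lt_top_iff.1 h, ENNReal.top_rpow_of_pos (by positivity)] at hf
    exact lt_irrefl _ hf
  refine ⟨sphMeasure n (unitSphere n) * ⨆ r ∈ Ioo (0 : ℝ) 1, hardyMean n p f r,
    (ENNReal.mul_lt_top hσ h1).ne, fun r hr => ?_⟩
  by_cases h0 : sphMeasure n (unitSphere n) = 0
  · have : sphMeasure n = 0 := by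
      rw [sphMeasure, Measure.restrict_apply_self] at h0
      rw [sphMeasure, Measure.restrict_eq_zero, h0]
    simp [this]
  · have h2 : hardyMean n p f r ≤ ⨆ r ∈ Ioo (0 : ℝ) 1, hardyMean n p f r :=
      le_iSup₂ (f := fun r (_ : r ∈ Ioo (0 : ℝ) 1) => hardyMean n p f r) r hr
    refine le_trans (le_of_eq ?_) (mul_le_mul_right h2 _)
    rw [hardyMean, ← mul_assoc, ENNReal.mul_inv_cancel h0 hσ.ne, one_mul]

theorem hp_radial_maximal_integral (n : ℕ) (hn : 2 ≤ n) (K C₀ α a C₁ p : ℝ)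
    (hK : 1 ≤ K) (hC₀ : 1 ≤ C₀) (hα : 0 < α) (ha0 : 0 ≤ a) (ha : a < (n : ℝ) - 1)
    (hC₁ : 0 < C₁) (hp0 : 0 < p) (hpn : p < n)
    (f : Vec n → Vec n) (hf : IsQR n K f) (hf0 : ∀ x ∈ unitBall n, f x ≠ 0)
    (hMin : InMiniowitz n C₀ α f) (hM : MultCond n a C₁ f) (hHp : MemHp n p f) :
    ∫⁻ r in Set.Ioo (0 : ℝ) 1,
        ENNReal.ofReal ((1 - r) ^ ((n : ℝ) - 2)) *
          (⨆ x ∈ Metric.sphere (0 : Vec n) r, ENNReal.ofReal ‖f x‖) ^ p < ⊤ := by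
  obtain ⟨c, hc, C, hC, hlow⟩ :=
    exists_le_mul_sphMeasure_radial_lower_bound hn hK hC₀ hα ha0 ha hC₁ hf hf0 hMin hM
  obtain ⟨A, hA, hfA⟩ := hHp.exists_lintegral_le hn hp0
  have key := lintegral_mul_iSup_sphere_lt_top hn (u := fun x => ‖f x‖ ^ p) (c := c ^ p)
    (hf.1.norm.rpow_const fun _ _ => Or.inr hp0.le) (by positivity) hC hA (fun x hx2 hx1 => by
      refine (hlow x hx2 hx1).trans ?_
      refine mul_le_mul_right (measure_mono ?_) _
      refine fun ω hω => ⟨hω.1, fun r hr => ?_⟩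
      rw [← Real.mul_rpow hc.le (norm_nonneg _)]
      exact Real.rpow_le_rpow (by positivity) (hω.2 r hr) hp0.le) hfA
  refine lt_of_le_of_lt (setLIntegral_mono' measurableSet_Ioo fun r hr => ?_) key
  have h1 : (1 - r) ^ ((n : ℝ) - 2) = (1 - r) ^ (n - 2) := by
    rw [← Real.rpow_natCast, Nat.cast_sub hn, Nat.cast_ofNat]
  rw [h1]
  gcongr
  rw [← ENNReal.le_rpow_inv_iff hp0]
  refine iSup₂_le fun x hx => ?_
  rw [ENNReal.le_rpow_inv_iff hp0, ENNReal.ofReal_rpow_of_nonneg (norm_nonneg _) hp0.le]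
  exact le_iSup₂ (f := fun x (_ : x ∈ sphere (0 : Vec n) r) => ENNReal.ofReal (‖f x‖ ^ p)) x hx

end
end
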